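/- arXiv:2406.13943 — 4 statements merged into one kernel-verified Lean document; each statement's English description precedes it below -/
import Mathlib

section
/- Let p be an odd prime, q = p^m a power of p, and suppose q = 2^a·b + 1 with b odd and a ≥ 2. Let r ≥ 2 and n = 2^r. Then the set T_n = {0, 2^{r−1}} ∪ ⋃_{i=2}^r { 2^{r−i}·s : s ∈ D_i } is a complete set of representatives of the q-cyclotomic cosets modulo 2^r: the cosets C_(t,2^r) for t ∈ T_n are pairwise disjoint and their union is all of Z/2^rZ. -/
/-- The `q`-cyclotomic coset of the integer `t` modulo `n`, viewed inside `ZMod n`: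
`C_(t,n) = { t·q^k mod n : k ≥ 0 }`. -/
def cycCoset (q n : ℕ) (t : ℤ) : Set (ZMod n) :=
  {z | ∃ k : ℕ, z = (t : ZMod n) * (q : ZMod n) ^ k}

/-- The powers of `3` up to sign that represent the odd residue classes modulo `2 ^ c`. -/
def oddReps (c : ℕ) : Set ℤ :=
  {s | (c ≤ 1 ∧ s = 1) ∨ (2 ≤ c ∧ ∃ v : ℕ, v < 2 ^ (c - 2) ∧ (s = 3 ^ v ∨ s = -(3 ^ v)))}

theorem odd_of_mem_oddReps {c : ℕ} {s : ℤ} (hs : s ∈ oddReps c) : Odd s := by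
  rcases hs with ⟨-, rfl⟩ | ⟨-, v, -, rfl | rfl⟩
  · exact odd_one
  · exact Odd.pow (by decide)
  · exact (Odd.pow (by decide)).neg

/-- Lifting the exponent for `q = 2 ^ a * b + 1` with `b` odd and `2 ≤ a`. -/
theorem two_pow_dvd_pow_sub_one_iff {a : ℕ} {b : ℤ} (hb : Odd b) (ha : 2 ≤ a) (j e : ℕ) :
    (2 : ℤ) ^ (a + j) ∣ (2 ^ a * b + 1) ^ e - 1 ↔ 2 ^ j ∣ e := by
  have h4 : (4 : ℤ) ∣ (2 ^ a * b + 1) - 1 := by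
    obtain ⟨c, rfl⟩ := Nat.exists_eq_add_of_le ha
    exact ⟨2 ^ c * b, by ring⟩
  have h2 : ¬ (2 : ℤ) ∣ 2 ^ a * b + 1 := by omega
  have hlte := Int.two_pow_sub_pow' e h4 h2
  have hval : emultiplicity (2 : ℤ) ((2 ^ a * b + 1) - 1) = a := by
    rw [add_sub_cancel_right, emultiplicity_mul Int.prime_two,
      emultiplicity_pow_self (by norm_num) (by decide),
      emultiplicity_eq_zero.2 (by rw [← even_iff_two_dvd]; simpa using hb), add_zero]
  rw [one_pow, hval] at hlte
  rw [pow_dvd_iff_le_emultiplicity, hlte, Nat.cast_add,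
    ENat.add_le_add_iff_left (ENat.natCast_ne_top a), ← pow_dvd_iff_le_emultiplicity]
  exact_mod_cast Iff.rfl

/-- An integer congruent to the odd integer `s` modulo `2 ^ a` is congruent modulo every power
of two to `s` times a power of `q = 2 ^ a * b + 1`. -/
theorem exists_two_pow_dvd_sub_mul_pow {a : ℕ} {b : ℤ} (hb : Odd b) (ha : 2 ≤ a) {s u : ℤ}
    (hs : Odd s) (hu : (2 : ℤ) ^ a ∣ u - s) (j : ℕ) :
    ∃ k : ℕ, (2 : ℤ) ^ (a + j) ∣ u - s * (2 ^ a * b + 1) ^ k := by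
  induction j with
  | zero => exact ⟨0, by simpa using hu⟩
  | succ j ih =>
    obtain ⟨k, w, hw⟩ := ih
    rcases Int.even_or_odd w with ⟨y, rfl⟩ | hwodd
    · exact ⟨k, y, by rw [hw]; ring⟩
    · obtain ⟨x, hx⟩ := (two_pow_dvd_pow_sub_one_iff hb ha j (2 ^ j)).2 dvd_rfl
      have hxodd : Odd x := by
        by_contra h
        obtain ⟨y, rfl⟩ := Int.not_odd_iff_even.1 h
        have hdvd := (two_pow_dvd_pow_sub_one_iff hb ha (j + 1) (2 ^ j)).1
          ⟨y, by rw [hx]; ring⟩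
        have := (Nat.pow_dvd_pow_iff_le_right (by norm_num : 1 < 2)).1 hdvd
        omega
      have hq : Odd ((2 : ℤ) ^ a * b + 1) := by
        obtain ⟨c, rfl⟩ := Nat.exists_eq_add_of_le ha
        exact ⟨2 * 2 ^ c * b, by ring⟩
      obtain ⟨y, hy⟩ := hwodd.sub_odd ((hs.mul (hq.pow (n := k))).mul hxodd)
      refine ⟨k + 2 ^ j, y, ?_⟩
      rw [pow_add _ k]
      linear_combination hw - s * (2 ^ a * b + 1) ^ k * hx + 2 ^ (a + j) * hy

theorem two_pow_dvd_three_pow_sub_one_iff (j e : ℕ) :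
    (2 : ℤ) ^ (3 + j) ∣ 3 ^ e - 1 ↔ 2 ^ (j + 1) ∣ e := by
  rcases Nat.even_or_odd' e with ⟨f, rfl | rfl⟩
  · have h := two_pow_dvd_pow_sub_one_iff odd_one (by norm_num : 2 ≤ 3) j f
    rw [pow_succ' 2 j, Nat.mul_dvd_mul_iff_left (by norm_num), ← h, pow_mul]
    norm_num
  · constructor
    · intro h
      have h8 : (8 : ℤ) ∣ 3 ^ (2 * f + 1) - 1 := (Dvd.intro (2 ^ j) (by ring)).trans h
      have h9 : (8 : ℤ) ∣ 9 ^ f - 1 := by simpa using sub_dvd_pow_sub_pow (9 : ℤ) 1 f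
      rw [pow_succ, pow_mul] at h8
      norm_num at h8
      omega
    · intro h
      have : 2 ∣ 2 * f + 1 := (Dvd.intro (2 ^ j) (by ring)).trans h
      omega

theorem exists_mem_oddReps (c : ℕ) {u : ℤ} (hu : Odd u) :
    ∃ s ∈ oddReps c, (2 : ℤ) ^ c ∣ u - s := by
  rcases Nat.lt_or_ge c 3 with hc | hc
  · have hu' : u % 2 = 1 := Int.odd_iff.1 hu
    interval_cases c
    · exact ⟨1, Or.inl ⟨by norm_num, rfl⟩, by simp⟩
    · exact ⟨1, Or.inl ⟨by norm_num, rfl⟩, by omega⟩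
    · rcases (by omega : (4 : ℤ) ∣ u - 1 ∨ (4 : ℤ) ∣ u - -1) with h | h
      · exact ⟨1, Or.inr ⟨le_rfl, 0, by simp⟩, by simpa using h⟩
      · exact ⟨-1, Or.inr ⟨le_rfl, 0, by simp⟩, by simpa using h⟩
  · obtain ⟨j, rfl⟩ := Nat.exists_eq_add_of_le hc
    have key : ∀ u : ℤ, (8 : ℤ) ∣ u - 1 ∨ (8 : ℤ) ∣ u - 3 →
        ∃ v : ℕ, v < 2 ^ (3 + j - 2) ∧ (2 : ℤ) ^ (3 + j) ∣ u - 3 ^ v := by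
      intro u hu
      have hex : ∃ v : ℕ, (2 : ℤ) ^ (3 + j) ∣ u - 3 ^ v := by
        rcases hu with h | h
        · obtain ⟨k, hk⟩ := exists_two_pow_dvd_sub_mul_pow odd_one (by norm_num : 2 ≤ 3) odd_one
            (by simpa using h) j
          exact ⟨2 * k, by rw [pow_mul]; norm_num at hk ⊢; exact hk⟩
        · obtain ⟨k, hk⟩ := exists_two_pow_dvd_sub_mul_pow odd_one (by norm_num : 2 ≤ 3)
            (by decide : Odd (3 : ℤ)) (by simpa using h) j
          exact ⟨2 * k + 1, by rw [pow_succ', pow_mul]; norm_num at hk ⊢; exact hk⟩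
      obtain ⟨v, hv⟩ := hex
      have hexp : 3 + j - 2 = j + 1 := by omega
      refine ⟨v % 2 ^ (3 + j - 2), Nat.mod_lt _ (by positivity), ?_⟩
      rw [hexp]
      have h1 := (two_pow_dvd_three_pow_sub_one_iff j (2 ^ (j + 1) * (v / 2 ^ (j + 1)))).2
        (Dvd.intro _ rfl)
      have h2 : (3 : ℤ) ^ v = 3 ^ (v % 2 ^ (j + 1)) * 3 ^ (2 ^ (j + 1) * (v / 2 ^ (j + 1))) := by
        rw [← pow_add, Nat.mod_add_div]
      exact (hv.add (h1.mul_left (3 ^ (v % 2 ^ (j + 1))))).trans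
        (dvd_of_eq (by rw [h2]; ring))
    have hu' : u % 2 = 1 := Int.odd_iff.1 hu
    rcases (by omega : ((8 : ℤ) ∣ u - 1 ∨ (8 : ℤ) ∣ u - 3) ∨
      ((8 : ℤ) ∣ -u - 1 ∨ (8 : ℤ) ∣ -u - 3)) with h | h
    · obtain ⟨v, hv, hd⟩ := key u h
      exact ⟨3 ^ v, Or.inr ⟨by omega, v, hv, Or.inl rfl⟩, hd⟩
    · obtain ⟨v, hv, hd⟩ := key (-u) h
      refine ⟨-(3 ^ v), Or.inr ⟨by omega, v, hv, Or.inr rfl⟩, ?_⟩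
      rw [← dvd_neg]
      exact hd.trans (dvd_of_eq (by ring))

theorem three_pow_mod_eight (v : ℕ) : (3 : ℤ) ^ v % 8 = 1 ∨ (3 : ℤ) ^ v % 8 = 3 := by
  induction v with
  | zero => simp
  | succ v ih => rw [pow_succ]; omega

theorem three_pow_inj_of_two_pow_dvd {c v w : ℕ} (hv : v < 2 ^ (c - 2)) (hw : w < 2 ^ (c - 2))
    (hvw : v ≤ w) (h : (2 : ℤ) ^ c ∣ 3 ^ w - 3 ^ v) : v = w := by
  rcases Nat.lt_or_ge c 3 with hc | hc
  · have : c - 2 = 0 := by omega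
    simp_all
  · obtain ⟨j, rfl⟩ := Nat.exists_eq_add_of_le hc
    obtain ⟨d, rfl⟩ := Nat.exists_eq_add_of_le hvw
    have hcop : IsCoprime ((2 : ℤ) ^ (3 + j)) (3 ^ v) :=
      IsCoprime.pow ⟨-1, 1, by norm_num⟩
    have h1 : (2 : ℤ) ^ (3 + j) ∣ 3 ^ d - 1 := by
      exact hcop.dvd_of_dvd_mul_left (h.trans (dvd_of_eq (by ring)))
    rw [two_pow_dvd_three_pow_sub_one_iff] at h1
    have hexp : 3 + j - 2 = j + 1 := by omega
    rw [hexp] at hw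
    have := Nat.eq_zero_of_dvd_of_lt h1 (by omega)
    omega

theorem oddReps_inj {c : ℕ} {s t : ℤ} (hs : s ∈ oddReps c) (ht : t ∈ oddReps c)
    (h : (2 : ℤ) ^ c ∣ s - t) : s = t := by
  rcases hs with ⟨h1, rfl⟩ | ⟨h2, v, hv, hs⟩ <;> rcases ht with ⟨h1', rfl⟩ | ⟨h2', w, hw, ht⟩
  · rfl
  · omega
  · omega
  · have pos : (2 : ℤ) ^ c ∣ 3 ^ v - 3 ^ w → v = w := by
      intro h
      rcases le_total v w with hvw | hvw
      · exact three_pow_inj_of_two_pow_dvd hv hw hvw (by rwa [dvd_sub_comm])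
      · exact (three_pow_inj_of_two_pow_dvd hw hv hvw h).symm
    have neg : ¬ (2 : ℤ) ^ c ∣ 3 ^ v + 3 ^ w := by
      intro h
      have h3v := three_pow_mod_eight v
      have h3w := three_pow_mod_eight w
      rcases Nat.lt_or_ge c 3 with hc | hc
      · obtain rfl : c = 2 := by omega
        have hv0 : v = 0 := by simpa using hv
        have hw0 : w = 0 := by simpa using hw
        subst hv0 hw0
        norm_num at h
      · have h8 : (8 : ℤ) ∣ 3 ^ v + 3 ^ w := by
          simpa using (pow_dvd_pow (2 : ℤ) hc).trans h
        omega
    rcases hs with rfl | rfl <;> rcases ht with rfl | rfl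
    · rw [pos h]
    · exact absurd (by simpa using h) neg
    · exact absurd (by rw [← dvd_neg]; exact h.trans (dvd_of_eq (by ring))) neg
    · rw [pos (by rw [← dvd_neg]; exact h.trans (dvd_of_eq (by ring)))]

theorem le_of_two_pow_dvd_sub {r e f : ℕ} {x y : ℤ} (hx : Odd x) (he : e < r)
    (h : (2 : ℤ) ^ r ∣ 2 ^ e * x - 2 ^ f * y) : f ≤ e := by
  by_contra! hlt
  have h1 : (2 : ℤ) ^ (e + 1) ∣ 2 ^ e * x :=
    (dvd_sub_left ((pow_dvd_pow 2 hlt).mul_right y)).1 ((pow_dvd_pow 2 he).trans h)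
  rw [pow_succ, mul_dvd_mul_iff_left (by positivity), ← even_iff_two_dvd] at h1
  exact Int.not_even_iff_odd.2 hx h1

/-- for `q = p^m = 2^a·b + 1` (`p` odd prime, `b` odd, `a ≥ 2`) and `r ≥ 2`,
the set `T_n = {0, 2^{r-1}} ∪ ⋃_{i=2}^r {2^{r-i}·s : s ∈ D_i}` is a complete set of
representatives of the `q`-cyclotomic cosets modulo `2^r`. -/
theorem stmt0 (p m a b r : ℕ) (hp : p.Prime) (hpodd : Odd p) (hm : 0 < m)
    (hb : Odd b) (ha : 2 ≤ a) (hq : p ^ m = 2 ^ a * b + 1) (hr : 2 ≤ r)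
    (D : ℕ → Set ℤ)
    (hD : ∀ i, 2 ≤ i → i ≤ r →
      D i = if i ≤ a then
          {x : ℤ | ∃ v : ℕ, v ≤ 2 ^ (i - 2) - 1 ∧ (x = 3 ^ v ∨ x = -(3 ^ v))}
        else
          {x : ℤ | ∃ v : ℕ, v ≤ 2 ^ (a - 2) - 1 ∧ (x = 3 ^ v ∨ x = -(3 ^ v))})
    (Tn : Set ℤ)
    (hTn : Tn = {0, 2 ^ (r - 1)} ∪ ⋃ i ∈ Set.Icc 2 r, (fun u : ℤ => 2 ^ (r - i) * u) '' D i) :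
    Tn.Pairwise (fun t₁ t₂ =>
        Disjoint (cycCoset (p ^ m) (2 ^ r) t₁) (cycCoset (p ^ m) (2 ^ r) t₂)) ∧
      ⋃ t ∈ Tn, cycCoset (p ^ m) (2 ^ r) t = Set.univ := by
  have hqz : ((p ^ m : ℕ) : ℤ) = 2 ^ a * b + 1 := by rw [hq]; push_cast; rfl
  have hbz : Odd (b : ℤ) := by exact_mod_cast hb
  have hqodd : Odd ((2 : ℤ) ^ a * b + 1) := by
    rw [← hqz]; exact_mod_cast hpodd.pow
  have hmem : ∀ t : ℤ, t ∈ Tn ↔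
      t = 0 ∨ ∃ e < r, ∃ s ∈ oddReps (min (r - e) a), t = 2 ^ e * s := by
    have hDmem : ∀ i, 2 ≤ i → i ≤ r → D i = oddReps (min i a) := by
      intro i h2 hir
      have aux : ∀ c : ℕ, 2 ≤ c →
          {x : ℤ | ∃ v : ℕ, v ≤ 2 ^ (c - 2) - 1 ∧ (x = 3 ^ v ∨ x = -(3 ^ v))} = oddReps c := by
        intro c hc
        ext x
        have hle : ∀ v : ℕ, v ≤ 2 ^ (c - 2) - 1 ↔ v < 2 ^ (c - 2) := fun v =>
          Nat.le_sub_one_iff_lt (by positivity)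
        simp [oddReps, hle, hc, show ¬ c ≤ 1 by omega]
      rw [hD i h2 hir]
      split_ifs with hia
      · rw [aux i h2, min_eq_left hia]
      · rw [aux a ha, min_eq_right (by omega)]
    intro t
    rw [hTn]
    simp only [Set.mem_union, Set.mem_insert_iff, Set.mem_singleton_iff, Set.mem_iUnion,
      Set.mem_image, Set.mem_Icc, exists_prop]
    constructor
    · rintro ((h | rfl) | ⟨i, ⟨h2, hir⟩, s, hs, rfl⟩)
      · exact Or.inl h
      · exact Or.inr ⟨r - 1, by omega, 1, Or.inl ⟨by omega, rfl⟩, by ring⟩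
      · refine Or.inr ⟨r - i, by omega, s, ?_, rfl⟩
        rwa [Nat.sub_sub_self hir, ← hDmem i h2 hir]
    · rintro (h | ⟨e, he, s, hs, rfl⟩)
      · exact Or.inl (Or.inl h)
      · rcases Nat.lt_or_ge (r - e) 2 with hlt | hge
        · obtain rfl : e = r - 1 := by omega
          rcases hs with ⟨-, rfl⟩ | ⟨h2, -⟩
          · exact Or.inl (Or.inr (by ring))
          · omega
        · refine Or.inr ⟨r - e, ⟨hge, by omega⟩, s, ?_, by rw [Nat.sub_sub_self he.le]⟩
          rwa [hDmem (r - e) hge (by omega)]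
  have hcast : ∀ (t : ℤ) (k : ℕ), (t : ZMod (2 ^ r)) * ((p ^ m : ℕ) : ZMod (2 ^ r)) ^ k =
      ((t * (2 ^ a * b + 1) ^ k : ℤ) : ZMod (2 ^ r)) := by
    intro t k
    rw [← hqz]; push_cast; rfl
  have hiff : ∀ x y : ℤ, (x : ZMod (2 ^ r)) = y ↔ (2 : ℤ) ^ r ∣ y - x := by
    intro x y
    rw [ZMod.intCast_eq_intCast_iff_dvd_sub]; push_cast; rfl
  constructor
  · intro t₁ h₁ t₂ h₂ hne
    rw [Set.disjoint_left]
    rintro z ⟨k, hk⟩ ⟨l, hl⟩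
    refine hne ?_
    have hd := hk.symm.trans hl
    rw [hcast, hcast, hiff] at hd
    rcases (hmem t₁).1 h₁ with rfl | ⟨e, he, s, hs, rfl⟩ <;>
      rcases (hmem t₂).1 h₂ with rfl | ⟨f, hf, t, ht, rfl⟩
    · rfl
    · have hto := (odd_of_mem_oddReps ht).mul (hqodd.pow (n := l))
      have := le_of_two_pow_dvd_sub (f := r) (y := 0) hto hf (by simpa [mul_assoc] using hd)
      omega
    · have hso := (odd_of_mem_oddReps hs).mul (hqodd.pow (n := k))
      have := le_of_two_pow_dvd_sub (f := r) (y := 0) hso he (by simpa [mul_assoc] using hd)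
      omega
    · have hso := (odd_of_mem_oddReps hs).mul (hqodd.pow (n := k))
      have hto := (odd_of_mem_oddReps ht).mul (hqodd.pow (n := l))
      rw [mul_assoc, mul_assoc] at hd
      obtain rfl : e = f := le_antisymm (le_of_two_pow_dvd_sub hto hf hd)
        (le_of_two_pow_dvd_sub hso he (by rwa [dvd_sub_comm]))
      rw [← mul_sub, ← Nat.add_sub_of_le he.le, pow_add,
        mul_dvd_mul_iff_left (by positivity)] at hd
      have hd' := (pow_dvd_pow (2 : ℤ) (min_le_left (r - e) a)).trans hd
      have hq1 : ∀ n : ℕ, (2 : ℤ) ^ min (r - e) a ∣ (2 ^ a * b + 1) ^ n - 1 := fun n =>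
        (pow_dvd_pow (2 : ℤ) (min_le_right (r - e) a)).trans
          ((two_pow_dvd_pow_sub_one_iff hbz ha 0 n).2 (by simp))
      rw [oddReps_inj hs ht]
      exact ((((hq1 l).mul_left t).sub ((hq1 k).mul_left s)).sub hd').trans
        (dvd_of_eq (by ring))
  · refine Set.eq_univ_of_forall fun z => ?_
    obtain ⟨x, rfl⟩ := ZMod.intCast_surjective z
    simp only [Set.mem_iUnion, exists_prop]
    by_cases hx : (2 : ℤ) ^ r ∣ x
    · refine ⟨0, (hmem 0).2 (Or.inl rfl), 0, ?_⟩
      rw [hcast, hiff]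
      simpa using hx
    · have hx0 : x ≠ 0 := by rintro rfl; exact hx (dvd_zero _)
      obtain ⟨e, u, hu, rfl⟩ :=
        (Int.finiteMultiplicity_iff.2 ⟨by norm_num, hx0⟩ :
          FiniteMultiplicity (2 : ℤ) x).exists_eq_pow_mul_and_not_dvd |>.elim
            fun u hu => (⟨_, u, hu.2, hu.1⟩ : ∃ (e : ℕ) (u : ℤ), ¬ (2 : ℤ) ∣ u ∧ x = 2 ^ e * u)
      have huodd : Odd u := by rwa [← Int.not_even_iff_odd, even_iff_two_dvd]
      have he : e < r := by
        by_contra! h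
        exact hx ((pow_dvd_pow 2 h).mul_right u)
      obtain ⟨s, hs, hsu⟩ := exists_mem_oddReps (min (r - e) a) huodd
      have hk : ∃ k : ℕ, (2 : ℤ) ^ (r - e) ∣ s * (2 ^ a * b + 1) ^ k - u := by
        rcases le_total (r - e) a with hle | hle
        · rw [min_eq_left hle] at hsu
          exact ⟨0, by simpa using (dvd_sub_comm.1 hsu)⟩
        · rw [min_eq_right hle] at hsu
          obtain ⟨k, hk⟩ := exists_two_pow_dvd_sub_mul_pow hbz ha (odd_of_mem_oddReps hs) hsu
            (r - e - a)
          rw [Nat.add_sub_of_le hle] at hk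
          exact ⟨k, dvd_sub_comm.1 hk⟩
      obtain ⟨k, hk⟩ := hk
      refine ⟨2 ^ e * s, (hmem _).2 (Or.inr ⟨e, he, s, hs, rfl⟩), k, ?_⟩
      rw [hcast, hiff, mul_assoc, ← mul_sub, ← Nat.add_sub_of_le he.le, pow_add]
      simpa only [Nat.add_sub_of_le he.le] using mul_dvd_mul_left _ hk
end

section
/- Let p be an odd prime, q = p^m with q = 2^a·b + 1, b odd, a ≥ 2, let r ≥ 2, and N = 2^r·p^s. Then for every ideal C of R = F_q[x]/(x^N − 1) there exist integers j_t with 0 ≤ j_t ≤ p^s for each t ∈ T_n such that C is generated by the image in R of the polynomial ∏_{t ∈ T_n} m_t(x)^{j_t}; conversely every such product generates an ideal of R. -/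
open Polynomial

/-- The set `D_i` (for `q = 2^a·b + 1`): `{3^v, −3^v : 0 ≤ v ≤ 2^{i−2}−1}` for `2 ≤ i ≤ a`,
and `{3^v, −3^v : 0 ≤ v ≤ 2^{a−2}−1}` for `a+1 ≤ i ≤ r`. -/
def Dfin (a i : ℕ) : Finset ℤ :=
  if i ≤ a then
    ((Finset.range (2 ^ (i - 2))).image fun v => (3 : ℤ) ^ v) ∪
      ((Finset.range (2 ^ (i - 2))).image fun v => -(3 : ℤ) ^ v)
  else
    ((Finset.range (2 ^ (a - 2))).image fun v => (3 : ℤ) ^ v) ∪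
      ((Finset.range (2 ^ (a - 2))).image fun v => -(3 : ℤ) ^ v)

/-- The complete set of representatives `T_n = {0, 2^{r−1}} ∪ ⋃_{i=2}^r 2^{r−i}·D_i`. -/
def TnD (a r : ℕ) : Finset ℤ :=
  {0, 2 ^ (r - 1)} ∪
    (Finset.Icc 2 r).biUnion fun i => (Dfin a i).image fun u => 2 ^ (r - i) * u

/-- Squaring lifts a congruence `x ≡ 1 + 2^a` modulo `2^(a+1)` to higher powers of two. -/
theorem pow_two_pow_eq_one_add {x c : ℤ} {a : ℕ} (ha : 2 ≤ a) (hc : Odd c)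
    (hx : x = 1 + 2 ^ a * c) (k : ℕ) :
    ∃ d : ℤ, Odd d ∧ x ^ 2 ^ k = 1 + 2 ^ (a + k) * d := by
  induction k with
  | zero => exact ⟨c, hc, by simpa using hx⟩
  | succ k ih =>
    obtain ⟨d, hd, h⟩ := ih
    obtain ⟨n, hn⟩ : ∃ n, a + k = n + 2 := ⟨a + k - 2, by lia⟩
    refine ⟨d + 2 ^ (n + 1) * d ^ 2, ?_, ?_⟩
    · exact hd.add_even ((even_two.pow_of_ne_zero (by lia)).mul_right _)
    · rw [pow_succ, pow_mul, h, ← add_assoc, hn]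
      ring

/-- If `x - 1` has `2`-adic valuation exactly `a ≥ 2`, the powers of `x` lift any odd residue
class modulo `2^a` to all the residue classes modulo `2^(a+k)` above it. -/
theorem exists_dvd_sub_mul_pow {x c y w : ℤ} {a : ℕ} (ha : 2 ≤ a) (hc : Odd c)
    (hx : x = 1 + 2 ^ a * c) (hy : Odd y) (hw : 2 ^ a ∣ w - y) (k : ℕ) :
    ∃ e < 2 ^ k, 2 ^ (a + k) ∣ w - y * x ^ e := by
  induction k with
  | zero => exact ⟨0, by simp, by simpa using hw⟩
  | succ k ih =>
    obtain ⟨e, he, z, hz⟩ := ih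
    rcases Int.even_or_odd z with ⟨t, ht⟩ | hzo
    · refine ⟨e, he.trans (Nat.pow_lt_pow_right (by lia) (by lia)), t, ?_⟩
      rw [hz, ht]
      ring
    · obtain ⟨d, hd, hxd⟩ := pow_two_pow_eq_one_add ha hc hx k
      have hxo : Odd x := by
        rw [hx]
        exact odd_one.add_even ((even_two.pow_of_ne_zero (by lia)).mul_right _)
      obtain ⟨t, ht⟩ : Even (z - y * x ^ e * d) := hzo.sub_odd ((hy.mul hxo.pow).mul hd)
      refine ⟨e + 2 ^ k, by rw [pow_succ]; lia, t, ?_⟩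
      calc w - y * x ^ (e + 2 ^ k) = (w - y * x ^ e) - y * x ^ e * (x ^ 2 ^ k - 1) := by ring
        _ = 2 ^ (a + k) * (z - y * x ^ e * d) := by rw [hz, hxd]; ring
        _ = _ := by rw [ht]; ring

/-- Every odd residue class modulo `2^i` with `i ≥ 2` is represented by an element of the form
`±3^v` with `v < 2^(i-2)`. -/
theorem exists_dvd_sub_sign_mul_three_pow {u : ℤ} (hu : Odd u) {i : ℕ} (hi : 2 ≤ i) :
    ∃ v < 2 ^ (i - 2), ∃ y : ℤ, (y = 3 ^ v ∨ y = -3 ^ v) ∧ 2 ^ i ∣ u - y := by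
  obtain ⟨w, rfl⟩ := hu
  rcases hi.eq_or_lt with rfl | hi
  · refine ⟨0, by simp, ?_⟩
    rcases Int.even_or_odd' w with ⟨t, rfl | rfl⟩
    · exact ⟨1, by simp, by lia⟩
    · exact ⟨-1, by simp, by lia⟩
  · obtain ⟨k, rfl⟩ : ∃ k, i = 3 + k := ⟨i - 3, by lia⟩
    have hmod : ∃ δ < 2, ∃ ε : ℤ, (ε = 1 ∨ ε = -1) ∧ (2 : ℤ) ^ 3 ∣ (2 * w + 1) - ε * 3 ^ δ := by
      have h : w % 4 = 0 ∨ w % 4 = 1 ∨ w % 4 = 2 ∨ w % 4 = 3 := by lia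
      rcases h with h | h | h | h
      · exact ⟨0, by simp, 1, by simp, by norm_num; lia⟩
      · exact ⟨1, by simp, 1, by simp, by norm_num; lia⟩
      · exact ⟨1, by simp, -1, by simp, by norm_num; lia⟩
      · exact ⟨0, by simp, -1, by simp, by norm_num; lia⟩
    obtain ⟨δ, hδ, ε, hε, h⟩ := hmod
    have hodd : Odd (ε * 3 ^ δ) := by
      refine Odd.mul ?_ (Odd.pow (by decide))
      rcases hε with rfl | rfl <;> decide
    obtain ⟨e, he, h9⟩ := exists_dvd_sub_mul_pow (x := 9) (c := 1) (a := 3) (by lia) odd_one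
      (by norm_num) hodd h k
    refine ⟨2 * e + δ, ?_, ε * 3 ^ (2 * e + δ), ?_, ?_⟩
    · rw [show 3 + k - 2 = k + 1 by lia, pow_succ]
      lia
    · rcases hε with rfl | rfl <;> simp
    · rw [show (9 : ℤ) = 3 ^ 2 by norm_num, ← pow_mul, mul_assoc, ← pow_add] at h9
      rwa [add_comm (2 * e)]

theorem mem_Dfin {a i v : ℕ} (hv : v < 2 ^ (min i a - 2)) {y : ℤ}
    (hy : y = 3 ^ v ∨ y = -3 ^ v) : y ∈ Dfin a i := by
  unfold Dfin
  split_ifs with h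
  · rw [min_eq_left h] at hv
    rcases hy with rfl | rfl <;> simp <;> grind
  · rw [min_eq_right (by lia)] at hv
    rcases hy with rfl | rfl <;> simp <;> grind

/-- The set `D_i` meets every orbit of multiplication by `q` on the odd residue classes
modulo `2^i`. -/
theorem exists_mem_Dfin {q c u : ℤ} {a i : ℕ} (ha : 2 ≤ a) (hc : Odd c)
    (hq : q = 1 + 2 ^ a * c) (hi : 2 ≤ i) (hu : Odd u) :
    ∃ y ∈ Dfin a i, ∃ e : ℕ, 2 ^ i ∣ u - y * q ^ e := by
  obtain ⟨v, hv, y, hy, h⟩ := exists_dvd_sub_sign_mul_three_pow hu (i := min i a) (by lia)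
  refine ⟨y, mem_Dfin hv hy, ?_⟩
  rcases le_total i a with hia | hia
  · rw [min_eq_left hia] at h
    exact ⟨0, by simpa using h⟩
  · rw [min_eq_right hia] at h
    have hyo : Odd y := by
      have h3 : Odd ((3 : ℤ) ^ v) := Odd.pow (by decide)
      rcases hy with rfl | rfl
      exacts [h3, h3.neg]
    obtain ⟨e, -, he⟩ := exists_dvd_sub_mul_pow ha hc hq hyo h (i - a)
    exact ⟨e, by rwa [Nat.add_sub_cancel' hia] at he⟩

/-- The set `T_n` meets every `q`-cyclotomic coset modulo `2^r`. -/
theorem exists_mem_TnD {q c : ℤ} {a r : ℕ} (ha : 2 ≤ a) (hc : Odd c)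
    (hq : q = 1 + 2 ^ a * c) (hr : 2 ≤ r) (k : ℤ) :
    ∃ t ∈ TnD a r, ∃ e : ℕ, 2 ^ r ∣ k - t * q ^ e := by
  by_cases h0 : (2 : ℤ) ^ r ∣ k
  · exact ⟨0, by simp [TnD], 0, by simpa using h0⟩
  have hk : k ≠ 0 := by
    rintro rfl
    simp at h0
  obtain ⟨u, hku, hu⟩ :=
    (Int.finiteMultiplicity_iff (a := 2).2 ⟨by decide, hk⟩).exists_eq_pow_mul_and_not_dvd
  rw [← even_iff_two_dvd, Int.not_even_iff_odd] at hu
  generalize multiplicity 2 k = n at hku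
  subst hku
  have hn : n < r := by
    by_contra! hn
    exact h0 ((pow_dvd_pow 2 hn).mul_right u)
  rcases Nat.lt_or_ge (r - n) 2 with h1 | h2
  · obtain rfl : n = r - 1 := by lia
    refine ⟨2 ^ (r - 1), by simp [TnD], 0, ?_⟩
    obtain ⟨w, rfl⟩ := hu
    refine ⟨w, ?_⟩
    nth_rewrite 3 [show r = r - 1 + 1 by lia]
    ring
  · obtain ⟨y, hy, e, he⟩ := exists_mem_Dfin ha hc hq h2 hu
    refine ⟨2 ^ n * y, ?_, e, ?_⟩
    · simp only [TnD, Finset.mem_union, Finset.mem_biUnion, Finset.mem_image, Finset.mem_Icc]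
      exact .inr ⟨r - n, ⟨h2, by lia⟩, y, hy, by rw [show r - (r - n) = n by lia]⟩
    · have := mul_dvd_mul_left ((2 : ℤ) ^ n) he
      rw [← pow_add, show n + (r - n) = r by lia] at this
      rwa [mul_sub, ← mul_assoc] at this

/-- A divisor of a product of powers of primes is, up to a unit, a product of smaller powers. -/
theorem exists_associated_prod_pow_of_dvd {ι M : Type*} [CommMonoidWithZero M]
    [IsCancelMulZero M] [DecompositionMonoid M] (T : Finset ι) (f : ι → M)
    (hf : ∀ i ∈ T, Prime (f i)) (n : ℕ) (g : M) (hg : g ∣ ∏ i ∈ T, f i ^ n) :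
    ∃ j : ι → ℕ, (∀ i, j i ≤ n) ∧ Associated g (∏ i ∈ T, f i ^ j i) := by
  classical
  induction T using Finset.induction_on generalizing g with
  | empty => exact ⟨0, by simp, by simpa [isUnit_iff_dvd_one] using hg⟩
  | insert i T hi ih =>
    rw [Finset.prod_insert hi] at hg
    obtain ⟨d₁, d₂, h₁, h₂, rfl⟩ := exists_dvd_and_dvd_of_dvd_mul hg
    obtain ⟨e, he, hd₁⟩ := (dvd_prime_pow (hf i (by simp)) n).1 h₁
    obtain ⟨j, hj, hd₂⟩ := ih (fun k hk => hf k (by simp [hk])) d₂ h₂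
    refine ⟨Function.update j i e, fun k => ?_, ?_⟩
    · by_cases hk : k = i
      · subst hk
        simpa using he
      · simpa [hk] using hj k
    · rw [Finset.prod_insert hi, Function.update_self]
      refine hd₁.mul_mul (hd₂.trans (.of_eq (Finset.prod_congr rfl fun k hk => ?_)))
      rw [Function.update_of_ne]
      rintro rfl
      exact hi hk

theorem aeval_minpoly_pow_card_pow {F E : Type*} [Field F] [Fintype F] [Field E] [Algebra F E]
    (x : E) (e : ℕ) : aeval (x ^ Fintype.card F ^ e) (minpoly F x) = 0 := by
  induction e with
  | zero => simp
  | succ e ih =>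
    have := aeval_algHom_apply (FiniteField.frobeniusAlgHom F E) (x ^ Fintype.card F ^ e)
      (minpoly F x)
    simpa only [ih, map_zero, FiniteField.coe_frobeniusAlgHom, ← pow_mul, ← pow_succ] using this

/-- If every `n`-th root of unity is a root of some `f i`, then `X ^ n - 1` divides `∏ f i`. -/
theorem X_pow_sub_one_dvd_prod {F E ι : Type*} [Field F] [Field E] [Algebra F E] {n : ℕ}
    (hn : 0 < n) {β : E} (hβ : IsPrimitiveRoot β n) (T : Finset ι) (f : ι → F[X])
    (h : ∀ k : ℕ, ∃ i ∈ T, aeval (β ^ k) (f i) = 0) : X ^ n - 1 ∣ ∏ i ∈ T, f i := by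
  rw [← map_dvd_map' (algebraMap F E), Polynomial.map_sub, Polynomial.map_pow, map_X,
    Polynomial.map_one, X_pow_sub_one_eq_prod hn hβ]
  refine Finset.prod_dvd_of_coprime
    (fun x _ y _ hxy => pairwise_coprime_X_sub_C Function.injective_id hxy) fun ζ hζ => ?_
  have : NeZero n := ⟨hn.ne'⟩
  obtain ⟨k, -, rfl⟩ := hβ.eq_pow_of_pow_eq_one ((mem_nthRootsFinset hn 1).1 hζ)
  obtain ⟨i, hi, h0⟩ := h k
  rw [Polynomial.map_prod]
  refine dvd_trans ?_ (Finset.dvd_prod_of_mem _ hi)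
  rwa [dvd_iff_isRoot, IsRoot.def, eval_map_algebraMap]

/-- An ideal of `F[x]/(h)` is generated by the class of some divisor of `h`. -/
theorem exists_dvd_eq_span_mk {F : Type*} [Field F] (h : F[X]) (C : Ideal (AdjoinRoot h)) :
    ∃ g, g ∣ h ∧ C = Ideal.span {AdjoinRoot.mk h g} := by
  obtain ⟨g, hg⟩ := (IsPrincipalIdealRing.principal (C.comap (AdjoinRoot.mk h))).principal
  refine ⟨g, ?_, ?_⟩
  · rw [← Ideal.mem_span_singleton, ← Ideal.submodule_span_eq, ← hg, Ideal.mem_comap,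
      AdjoinRoot.mk_self]
    exact C.zero_mem
  · rw [← Ideal.map_comap_of_surjective _ AdjoinRoot.mk_surjective C, hg,
      Ideal.submodule_span_eq, Ideal.map_span, Set.image_singleton]

/-- every cyclic code of length `2^r·p^s` over `F_q` (`q = p^m = 2^a·b+1`),
i.e. every ideal of `F_q[x]/(x^N − 1)`, is generated by `∏_{t ∈ T_n} m_t(x)^{j_t}` with
`0 ≤ j_t ≤ p^s`, where `m_t` is the minimal polynomial over `F_q` of `β^t` for a primitive
`2^r`-th root of unity `β`; conversely, any such product generates an ideal. -/
theorem stmt6 (p m a b r s : ℕ) (hp : p.Prime) (hpodd : Odd p) (hm : 0 < m) (hs : 0 < s)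
    (hb : Odd b) (ha : 2 ≤ a) (hr : 2 ≤ r) (hq : p ^ m = 2 ^ a * b + 1)
    (F : Type*) [Field F] [Fintype F] (hF : Fintype.card F = p ^ m)
    (E : Type*) [Field E] [Algebra F E] (β : E) (hβ : IsPrimitiveRoot β (2 ^ r))
    (N : ℕ) (hN : N = 2 ^ r * p ^ s)
    (C : Ideal (AdjoinRoot (X ^ N - 1 : Polynomial F))) :
    (∃ j : ℤ → ℕ, (∀ t ∈ TnD a r, j t ≤ p ^ s) ∧
        C = Ideal.span {AdjoinRoot.mk (X ^ N - 1 : Polynomial F)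
          (∏ t ∈ TnD a r, minpoly F (β ^ t) ^ j t)}) ∧
      ∀ j : ℤ → ℕ, ∃ C' : Ideal (AdjoinRoot (X ^ N - 1 : Polynomial F)),
        C' = Ideal.span {AdjoinRoot.mk (X ^ N - 1 : Polynomial F)
          (∏ t ∈ TnD a r, minpoly F (β ^ t) ^ j t)} := by
  refine ⟨?_, fun j => ⟨_, rfl⟩⟩
  have : Fact p.Prime := ⟨hp⟩
  have : CharP F p := charP_of_card_eq_prime_pow hF
  obtain ⟨g, hg, rfl⟩ := exists_dvd_eq_span_mk _ C
  have hβint : IsIntegral F β :=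
    IsIntegral.of_pow (n := 2 ^ r) (by positivity) (by rw [hβ.pow_eq_one]; exact isIntegral_one)
  have hβ0 : β ≠ 0 := hβ.ne_zero (by positivity)
  have hint (t : ℤ) : IsIntegral F (β ^ t) := by
    rcases t with t | t
    · simpa using hβint.pow t
    · rw [zpow_negSucc]
      exact (hβint.pow _).inv
  have hroot (k : ℕ) : ∃ t ∈ TnD a r, aeval (β ^ k) (minpoly F (β ^ t)) = 0 := by
    obtain ⟨t, ht, e, he⟩ := exists_mem_TnD (q := (p ^ m : ℕ)) (c := b) ha (by exact_mod_cast hb)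
      (by rw [hq]; push_cast; ring) hr k
    refine ⟨t, ht, ?_⟩
    convert aeval_minpoly_pow_card_pow (F := F) (β ^ t) e using 2
    have h1 : β ^ ((k : ℤ) - t * ((p ^ m : ℕ) : ℤ) ^ e) = 1 :=
      (hβ.zpow_eq_one_iff_dvd _).2 (by exact_mod_cast he)
    rw [zpow_sub₀ hβ0, div_eq_one_iff_eq (zpow_ne_zero _ hβ0)] at h1
    rw [← zpow_natCast β k, h1, zpow_mul, hF, ← zpow_natCast (β ^ t)]
    push_cast
    rfl
  have hdvd : g ∣ ∏ t ∈ TnD a r, minpoly F (β ^ t) ^ p ^ s := by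
    refine hg.trans ?_
    rw [hN, pow_mul, Finset.prod_pow, ← one_pow (p ^ s), ← sub_pow_char_pow]
    exact pow_dvd_pow_of_dvd (X_pow_sub_one_dvd_prod (by positivity) hβ _ _ hroot) _
  obtain ⟨j, hj, hgj⟩ := exists_associated_prod_pow_of_dvd _ _
    (fun t _ => minpoly.prime (hint t)) _ _ hdvd
  exact ⟨j, fun t _ => hj t, le_antisymm
    (Ideal.span_singleton_le_span_singleton.2 (map_dvd _ hgj.dvd'))
    (Ideal.span_singleton_le_span_singleton.2 (map_dvd _ hgj.dvd))⟩
end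

section
/- Let p be an odd prime, q = p^m with q = 2^a·b + 1, b odd, a ≥ 2, let r ≥ 2, and N = 2^r·p^s. Let C be the ideal of R = F_q[x]/(x^N − 1) generated by m_0(x)^{j_0} · m_{2^{r−1}}(x)^{j_{2^{r−1}}} · ∏_{i=2}^r ∏_{s ∈ D_i} m_{2^{r−i}s}(x)^{j_{2^{r−i}s}}, where 0 ≤ j_t ≤ p^s for each t ∈ T_n. Then the dual code C^⊥ is the ideal of R generated by m_0(x)^{p^s−j_0} · m_{2^{r−1}}(x)^{p^s−j_{2^{r−1}}} · ∏_{i=2}^r ∏_{s ∈ D_i} m_{2^{r−i}s}(x)^{p^s−j_{2^{r−i}(−s)}}, where for s ∈ D_i the element −s also lies in D_i and j_{2^{r−i}(−s)} is the exponent attached to the representative 2^{r−i}·(−s). -/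
open Polynomial

/-- The coefficient vector (with respect to the basis `1, x, …, x^{deg f − 1}` of
`F[x]/(f)`) of an element of `F[x]/(f)`. -/
noncomputable def coeffRepr {F : Type*} [Field F] {f : Polynomial F} (hf : f ≠ 0)
    (x : AdjoinRoot f) (i : Fin (AdjoinRoot.powerBasis hf).dim) : F :=
  (AdjoinRoot.powerBasis hf).basis.repr x i

/-- The (Euclidean) dual code of a cyclic code `C ⊆ F[x]/(f)`: all elements whose
coefficient vector is orthogonal to the coefficient vector of every codeword of `C`. -/
noncomputable def dualCode {F : Type*} [Field F] {f : Polynomial F} (hf : f ≠ 0)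
    (C : Ideal (AdjoinRoot f)) : Set (AdjoinRoot f) :=
  {x | ∀ y ∈ C, ∑ i, coeffRepr hf x i * coeffRepr hf y i = 0}

section CyclicDual

variable {F : Type*} [Field F] {N : ℕ}

lemma root_pow_eq_one : AdjoinRoot.root (X ^ N - 1 : F[X]) ^ N = 1 := by
  have h := AdjoinRoot.mk_self (f := (X ^ N - 1 : F[X]))
  rwa [map_sub, map_pow, map_one, AdjoinRoot.mk_X, sub_eq_zero] at h

/-- The algebra endomorphism of `F[x]/(x^N − 1)` sending `x` to `x⁻¹ = x^(N−1)`. -/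
noncomputable def rootInvHom (F : Type*) [Field F] (N : ℕ) :
    AdjoinRoot (X ^ N - 1 : F[X]) →ₐ[F] AdjoinRoot (X ^ N - 1 : F[X]) :=
  AdjoinRoot.liftAlgHom _ (Algebra.ofId F _) (AdjoinRoot.root (X ^ N - 1 : F[X]) ^ (N - 1)) (by
    simp [← pow_mul, mul_comm (N - 1) N, pow_mul _ N, root_pow_eq_one])

lemma rootInvHom_root :
    rootInvHom F N (AdjoinRoot.root _) = AdjoinRoot.root (X ^ N - 1 : F[X]) ^ (N - 1) := by
  simp [rootInvHom]

lemma root_mul_rootInvHom_root (hN : N ≠ 0) :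
    AdjoinRoot.root _ * rootInvHom F N (AdjoinRoot.root _) = 1 := by
  rw [rootInvHom_root, mul_pow_sub_one hN, root_pow_eq_one]

lemma rootInvHom_rootInvHom (hN : N ≠ 0) (x : AdjoinRoot (X ^ N - 1 : F[X])) :
    rootInvHom F N (rootInvHom F N x) = x := by
  have h : (rootInvHom F N).comp (rootInvHom F N) = AlgHom.id F _ := by
    refine AdjoinRoot.algHom_ext ?_
    have h₁ := root_mul_rootInvHom_root (F := F) hN
    have h₂ := congrArg (rootInvHom F N) h₁
    rw [map_mul, map_one] at h₂
    simp only [AlgHom.comp_apply, AlgHom.id_apply]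
    exact (left_inv_eq_right_inv h₁ h₂).symm
  exact DFunLike.congr_fun h x

lemma powerBasis_repr_root_pow (hf : (X ^ N - 1 : F[X]) ≠ 0)
    (i₀ : Fin (AdjoinRoot.powerBasis hf).dim) (h₀ : (i₀ : ℕ) = 0) (k : ℕ) :
    (AdjoinRoot.powerBasis hf).basis.repr (AdjoinRoot.root _ ^ k) i₀ = if N ∣ k then 1 else 0 := by
  have hdim : (AdjoinRoot.powerBasis hf).dim = N := by
    rw [AdjoinRoot.powerBasis_dim]; exact natDegree_X_pow_sub_C (r := (1 : F))
  have hN : 0 < N := hdim ▸ i₀.pos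
  have hk : k % N < (AdjoinRoot.powerBasis hf).dim := by rw [hdim]; exact Nat.mod_lt _ hN
  have h : AdjoinRoot.root (X ^ N - 1 : F[X]) ^ k =
      (AdjoinRoot.powerBasis hf).basis ⟨k % N, hk⟩ := by
    rw [PowerBasis.basis_eq_pow, AdjoinRoot.powerBasis_gen]
    conv_lhs => rw [← Nat.mod_add_div k N, pow_add, pow_mul, root_pow_eq_one, one_pow, mul_one]
  rw [h, Module.Basis.repr_self, Finsupp.single_apply]
  simp only [Fin.ext_iff, h₀, Nat.dvd_iff_mod_eq_zero]

lemma sum_coeffRepr_mul (hf : (X ^ N - 1 : F[X]) ≠ 0)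
    (i₀ : Fin (AdjoinRoot.powerBasis hf).dim) (h₀ : (i₀ : ℕ) = 0)
    (x y : AdjoinRoot (X ^ N - 1 : F[X])) :
    ∑ i, coeffRepr hf x i * coeffRepr hf y i = coeffRepr hf (x * rootInvHom F N y) i₀ := by
  have hdim : (AdjoinRoot.powerBasis hf).dim = N := by
    rw [AdjoinRoot.powerBasis_dim]; exact natDegree_X_pow_sub_C (r := (1 : F))
  set B := (AdjoinRoot.powerBasis hf).basis with hB
  have hmul (i k) : B.repr (B i * rootInvHom F N (B k)) i₀ = if i = k then 1 else 0 := by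
    rw [hB, PowerBasis.basis_eq_pow, PowerBasis.basis_eq_pow, AdjoinRoot.powerBasis_gen, map_pow,
      rootInvHom_root, ← pow_mul, ← pow_add, powerBasis_repr_root_pow hf i₀ h₀]
    refine if_congr ?_ rfl rfl
    have hi : (i : ℕ) < N := i.2.trans_eq hdim
    have hk : (k : ℕ) < N := k.2.trans_eq hdim
    have h : (i : ℕ) + (N - 1) * k = N * k + i - k := by
      rw [Nat.sub_mul, one_mul]
      have := Nat.le_mul_of_pos_left (k : ℕ) (by lia : 0 < N)
      rw [← Nat.add_sub_assoc this, add_comm (i : ℕ)]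
    have h' : (k : ℕ) ≤ N * k + i :=
      (Nat.le_mul_of_pos_left (k : ℕ) (by lia : 0 < N)).trans (Nat.le_add_right _ _)
    rw [h, ← Nat.modEq_iff_dvd' h', Fin.ext_iff, Nat.ModEq, Nat.mul_add_mod,
      Nat.mod_eq_of_lt hi, Nat.mod_eq_of_lt hk, eq_comm]
  simp only [coeffRepr]
  rw [← hB]
  conv_rhs => rw [← B.sum_repr x, ← B.sum_repr y]
  simp only [map_sum, map_smul, Finset.sum_mul_sum, smul_mul_smul_comm, Finsupp.coe_finsetSum,
    Finset.sum_apply, Finsupp.smul_apply, hmul]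
  simp

lemma dualCode_span_singleton (hf : (X ^ N - 1 : F[X]) ≠ 0) {G H : F[X]}
    (hGH : G * H = X ^ N - 1) :
    dualCode hf (Ideal.span {AdjoinRoot.mk _ G}) =
      ↑(Ideal.span {rootInvHom F N (AdjoinRoot.mk _ H)}) := by
  have hN : N ≠ 0 := by rintro rfl; simp at hf
  have hdim : (AdjoinRoot.powerBasis hf).dim = N := by
    rw [AdjoinRoot.powerBasis_dim]; exact natDegree_X_pow_sub_C (r := (1 : F))
  have hinv := rootInvHom_rootInvHom (F := F) hN
  have hG : G ≠ 0 := by rintro rfl; exact hf (by simpa using hGH.symm)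
  let i₀ : Fin (AdjoinRoot.powerBasis hf).dim := ⟨0, by lia⟩
  have hdual (x) : x ∈ dualCode hf (Ideal.span {AdjoinRoot.mk _ G}) ↔
      x * rootInvHom F N (AdjoinRoot.mk _ G) = 0 := by
    simp only [dualCode, Set.mem_ofPred_eq, sum_coeffRepr_mul hf i₀ rfl]
    constructor
    · intro h
      refine (AdjoinRoot.powerBasis hf).basis.ext_elem fun i => ?_
      have := h (AdjoinRoot.mk _ G * (AdjoinRoot.powerBasis hf).basis i)
        (Ideal.mul_mem_right _ _ (Ideal.mem_span_singleton_self _))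
      rw [map_mul, ← mul_assoc, ← sum_coeffRepr_mul hf i₀ rfl] at this
      simp only [coeffRepr, Module.Basis.repr_self, Finsupp.single_apply] at this
      simpa using this
    · intro h y hy
      obtain ⟨z, rfl⟩ := Ideal.mem_span_singleton.1 hy
      rw [map_mul, ← mul_assoc, h]
      simp [coeffRepr]
  ext x
  rw [hdual, SetLike.mem_coe, Ideal.mem_span_singleton]
  have h₁ : x * rootInvHom F N (AdjoinRoot.mk _ G) = 0 ↔
      rootInvHom F N x * AdjoinRoot.mk _ G = 0 := by
    constructor <;> intro h <;> have := congrArg (rootInvHom F N) h <;> simpa [hinv] using this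
  have h₂ : rootInvHom F N (AdjoinRoot.mk _ H) ∣ x ↔
      AdjoinRoot.mk _ H ∣ rootInvHom F N x := by
    constructor <;> intro h <;> have := map_dvd (rootInvHom F N) h <;> simpa [hinv] using this
  rw [h₁, h₂]
  obtain ⟨P, hP⟩ := AdjoinRoot.mk_surjective (rootInvHom F N x)
  rw [← hP, ← map_mul, AdjoinRoot.mk_eq_zero]
  constructor
  · intro h
    refine map_dvd _ ((mul_dvd_mul_iff_left hG).1 ?_)
    rwa [hGH, mul_comm G P]
  · rintro ⟨y, hy⟩
    obtain ⟨Q, rfl⟩ := AdjoinRoot.mk_surjective y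
    rw [← AdjoinRoot.mk_eq_zero, map_mul, hy, ← map_mul, ← map_mul, AdjoinRoot.mk_eq_zero, ← hGH]
    exact ⟨Q, by ring⟩

lemma associated_rootInvHom_mk (hN : N ≠ 0) (P : F[X]) :
    Associated (rootInvHom F N (AdjoinRoot.mk _ P)) (AdjoinRoot.mk _ P.reverse) := by
  have h := root_mul_rootInvHom_root (F := F) hN
  let : Invertible (rootInvHom F N (AdjoinRoot.root _)) :=
    ⟨AdjoinRoot.root _, h, by rw [mul_comm, h]⟩
  have key := eval₂_reverse_mul_pow (algebraMap F (AdjoinRoot (X ^ N - 1 : F[X])))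
    (rootInvHom F N (AdjoinRoot.root _)) P
  have h₁ : eval₂ (algebraMap F (AdjoinRoot (X ^ N - 1 : F[X])))
      (⅟(rootInvHom F N (AdjoinRoot.root _))) P.reverse = AdjoinRoot.mk _ P.reverse := by
    exact AdjoinRoot.aeval_eq _
  have h₂ : eval₂ (algebraMap F (AdjoinRoot (X ^ N - 1 : F[X])))
      (rootInvHom F N (AdjoinRoot.root _)) P = rootInvHom F N (AdjoinRoot.mk _ P) := by
    rw [← AdjoinRoot.aeval_eq, ← aeval_algHom_apply, aeval_def]
  rw [h₁, h₂] at key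
  rw [← key]
  exact (associated_mul_unit_left _ _ ((isUnit_of_invertible _).pow _))

end CyclicDual

lemma associated_minpoly_inv {F E : Type*} [Field F] [Field E] [Algebra F E] {x : E}
    (hx : IsIntegral F x) (h0 : x ≠ 0) :
    Associated (minpoly F x).reverse (minpoly F x⁻¹) := by
  have hdvd {y : E} (h0 : y ≠ 0) : minpoly F y⁻¹ ∣ (minpoly F y).reverse := by
    let := invertibleOfNonzero h0
    refine minpoly.dvd _ _ ?_
    rw [aeval_def, ← invOf_eq_inv, eval₂_reverse_eq_zero_iff, ← aeval_def, minpoly.aeval]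
  have hdeg {y : E} (hy : IsIntegral F y) (h0 : y ≠ 0) :
      (minpoly F y⁻¹).natDegree ≤ (minpoly F y).natDegree :=
    (natDegree_le_of_dvd (hdvd h0) (by simpa using minpoly.ne_zero hy)).trans
      (reverse_natDegree_le _)
  refine (associated_of_dvd_of_natDegree_le (hdvd h0) (by simpa using minpoly.ne_zero hx)
    ((reverse_natDegree_le _).trans ?_)).symm
  simpa using hdeg hx.inv (inv_ne_zero h0)

section TwoPower

lemma exists_pow_two_pow_eq {Q : ℤ} {n : ℕ} (hn : 2 ≤ n) {b : ℤ} (hb : Odd b)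
    (hQ : Q = 2 ^ n * b + 1) (k : ℕ) : ∃ c, Odd c ∧ Q ^ 2 ^ k = 2 ^ (n + k) * c + 1 := by
  induction k with
  | zero => exact ⟨b, hb, by simpa using hQ⟩
  | succ k ih =>
    obtain ⟨c, hc, h⟩ := ih
    obtain ⟨l, hl⟩ : ∃ l, n + k = l + 2 := ⟨n + k - 2, by lia⟩
    refine ⟨c + 2 * (2 ^ l * c ^ 2), hc.add_even (even_two_mul _), ?_⟩
    rw [pow_succ, pow_mul, h, ← add_assoc, hl]
    ring

lemma exists_pow_modEq {Q : ℤ} {n : ℕ} (hn : 2 ≤ n) {b : ℤ} (hb : Odd b)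
    (hQ : Q = 2 ^ n * b + 1) {z : ℤ} (hz : z ≡ 1 [ZMOD 2 ^ n]) (k : ℕ) :
    ∃ e < 2 ^ k, Q ^ e ≡ z [ZMOD 2 ^ (n + k)] := by
  induction k with
  | zero => exact ⟨0, by simp, by simpa using hz.symm⟩
  | succ k ih =>
    obtain ⟨e, he, h⟩ := ih
    obtain ⟨c, hc, hQc⟩ := exists_pow_two_pow_eq hn hb hQ k
    obtain ⟨d, hd⟩ := h.dvd
    rcases Int.even_or_odd' d with ⟨l, hl | hl⟩
    · refine ⟨e, he.trans (Nat.pow_lt_pow_right (by simp) (by simp)), ?_⟩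
      refine (Int.modEq_iff_dvd).2 ⟨l, ?_⟩
      rw [hd, hl]; ring
    · refine ⟨e + 2 ^ k, by rw [pow_succ]; lia, ?_⟩
      have hodd : Odd (Q ^ e) := by
        refine Odd.pow ?_
        rw [hQ]
        exact (((even_two.pow_of_ne_zero (by lia)).mul_right b)).add_one
      obtain ⟨w, hw⟩ := hodd.mul hc
      refine (Int.modEq_iff_dvd).2 ⟨l - w, ?_⟩
      rw [pow_add, hQc]
      have : z = Q ^ e + 2 ^ (n + k) * d := by rw [← hd]; ring
      rw [this, hl, ← add_assoc, pow_succ]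
      linear_combination (-(2 ^ (n + k) : ℤ)) * hw

lemma neg_three_pow_injOn {d : ℕ} {v w : ℕ} (hv : v < 2 ^ d) (hw : w < 2 ^ d)
    (h : (-3 : ℤ) ^ v ≡ (-3) ^ w [ZMOD 2 ^ (d + 2)]) : v = w := by
  have ho := ZMod.orderOf_one_add_four_mul (-1) (by decide) d
  refine pow_injOn_Iio_orderOf (x := (1 + 4 * ((-1 : ℤ) : ZMod (2 ^ (d + 2))))) (by rwa [ho])
    (by rwa [ho]) ?_
  have := (ZMod.intCast_eq_intCast_iff _ _ (2 ^ (d + 2))).2 (by exact_mod_cast h)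
  push_cast at this ⊢
  norm_num
  simpa using this

end TwoPower

lemma mem_Dfin_s7 {a i : ℕ} {u : ℤ} :
    u ∈ Dfin a i ↔ ∃ v < 2 ^ (min i a - 2), u = (-3) ^ v ∨ u = -(-3) ^ v := by
  have h (d : ℕ) : (u ∈ ((Finset.range (2 ^ d)).image fun v => (3 : ℤ) ^ v) ∪
      ((Finset.range (2 ^ d)).image fun v => -(3 : ℤ) ^ v)) ↔
      ∃ v < 2 ^ d, u = (-3) ^ v ∨ u = -(-3) ^ v := by
    simp only [Finset.mem_union, Finset.mem_image, Finset.mem_range]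
    rw [← exists_or]
    refine exists_congr fun v => ?_
    rw [← and_or_left]
    refine and_congr_right fun _ => ?_
    rw [eq_comm, eq_comm (b := u)]
    rcases Nat.even_or_odd v with hv | hv
    · rw [hv.neg_pow]
    · rw [hv.neg_pow, neg_neg, or_comm]
  unfold Dfin
  split_ifs with hi
  · rw [min_eq_left hi]; exact h _
  · rw [min_eq_right (by lia)]; exact h _

lemma neg_mem_Dfin {a i : ℕ} {u : ℤ} (hu : u ∈ Dfin a i) : -u ∈ Dfin a i := by
  obtain ⟨v, hv, rfl | rfl⟩ := mem_Dfin_s7.1 hu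
  · exact mem_Dfin_s7.2 ⟨v, hv, Or.inr rfl⟩
  · exact mem_Dfin_s7.2 ⟨v, hv, Or.inl (neg_neg _)⟩

lemma odd_of_mem_Dfin {a i : ℕ} {u : ℤ} (hu : u ∈ Dfin a i) : Odd u := by
  obtain ⟨v, -, rfl | rfl⟩ := mem_Dfin_s7.1 hu
  · exact Odd.pow (by decide)
  · exact (Odd.pow (by decide)).neg

lemma eq_of_mem_Dfin_of_modEq {a i : ℕ} (ha : 2 ≤ a) (hi : 2 ≤ i) {u u' : ℤ} (hu : u ∈ Dfin a i)
    (hu' : u' ∈ Dfin a i) (h : u ≡ u' [ZMOD 2 ^ min i a]) : u = u' := by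
  obtain ⟨d, hd⟩ : ∃ d, min i a = d + 2 := ⟨min i a - 2, by lia⟩
  obtain ⟨v, hv, hu⟩ := mem_Dfin_s7.1 hu
  obtain ⟨w, hw, hu'⟩ := mem_Dfin_s7.1 hu'
  rw [hd, Nat.add_sub_cancel] at hv hw
  rw [hd] at h
  have h4 : u ≡ u' [ZMOD 4] := h.of_dvd ⟨2 ^ d, by ring⟩
  have hone (v : ℕ) : (-3 : ℤ) ^ v ≡ 1 [ZMOD 4] := by
    simpa using (show (-3 : ℤ) ≡ 1 [ZMOD 4] by decide).pow v
  have hne (v w : ℕ) : ¬ (-3 : ℤ) ^ v ≡ -(-3) ^ w [ZMOD 4] := fun h =>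
    absurd (((hone v).symm.trans h).trans (hone w).neg) (by decide)
  rcases hu with rfl | rfl <;> rcases hu' with rfl | rfl
  · rw [neg_three_pow_injOn hv hw h]
  · exact absurd h4 (hne v w)
  · exact absurd h4.symm (hne w v)
  · rw [neg_three_pow_injOn hv hw (by simpa using h.neg)]

lemma exists_mem_Dfin_modEq {a i : ℕ} (ha : 2 ≤ a) (hi : 2 ≤ i) {w : ℤ} (hw : Odd w) :
    ∃ u ∈ Dfin a i, u ≡ w [ZMOD 2 ^ min i a] := by
  obtain ⟨d, hd⟩ : ∃ d, min i a = 2 + d := ⟨min i a - 2, by lia⟩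
  have key {z : ℤ} (hz : z ≡ 1 [ZMOD 4]) : ∃ v < 2 ^ d, (-3) ^ v ≡ z [ZMOD 2 ^ (2 + d)] :=
    exists_pow_modEq le_rfl (b := -1) (by decide) (by norm_num) (by simpa using hz) d
  have h4 : w ≡ 1 [ZMOD 4] ∨ -w ≡ 1 [ZMOD 4] := by
    obtain ⟨l, rfl⟩ := hw
    simp only [Int.ModEq]
    lia
  rw [hd]
  rcases h4 with h | h
  · obtain ⟨v, hv, h⟩ := key h
    exact ⟨_, mem_Dfin_s7.2 ⟨v, by simpa [hd] using hv, Or.inl rfl⟩, h⟩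
  · obtain ⟨v, hv, h⟩ := key h
    exact ⟨_, mem_Dfin_s7.2 ⟨v, by simpa [hd] using hv, Or.inr rfl⟩, by simpa using h.neg⟩

/-- Representatives of the cyclotomic cosets modulo `2^r` for `q = 2^a·b + 1`. -/
def cosetReps (a r : ℕ) : Finset ℤ :=
  {0, 2 ^ (r - 1)} ∪
    (Finset.Icc 2 r).biUnion (fun i => (Dfin a i).image fun u => 2 ^ (r - i) * u)

lemma mem_cosetReps {a r : ℕ} {t : ℤ} : t ∈ cosetReps a r ↔
    t = 0 ∨ t = 2 ^ (r - 1) ∨ ∃ i, (2 ≤ i ∧ i ≤ r) ∧ ∃ u ∈ Dfin a i, 2 ^ (r - i) * u = t := by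
  simp [cosetReps]

lemma two_pow_mul_odd_inj {k l : ℕ} {u v : ℤ} (hu : Odd u) (hv : Odd v)
    (h : 2 ^ k * u = 2 ^ l * v) : k = l := by
  have key {k l : ℕ} {u v : ℤ} (hu : Odd u) (h : 2 ^ k * u = 2 ^ l * v) : l ≤ k := by
    by_contra! hlt
    obtain ⟨d, rfl⟩ := Nat.exists_eq_add_of_lt hlt
    have : u = 2 * (2 ^ d * v) := by
      refine mul_left_cancel₀ (pow_ne_zero k (two_ne_zero (α := ℤ))) ?_
      rw [h]; ring
    exact Int.not_even_iff_odd.2 hu (this ▸ even_two_mul _)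
  exact le_antisymm (key hv h.symm) (key hu h)

lemma prod_cosetReps {a r : ℕ} {M : Type*} [CommMonoid M] (g : ℤ → M) :
    ∏ t ∈ cosetReps a r, g t =
      g 0 * g (2 ^ (r - 1)) * ∏ i ∈ Finset.Icc 2 r, ∏ u ∈ Dfin a i, g (2 ^ (r - i) * u) := by
  have hinj {i k : ℕ} (hi : i ≤ r) (hk : k ≤ r) {u v : ℤ} (hu : Odd u) (hv : Odd v)
      (h : (2 : ℤ) ^ (r - i) * u = 2 ^ (r - k) * v) : i = k := by
    have := two_pow_mul_odd_inj hu hv h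
    lia
  rw [cosetReps, Finset.prod_union, Finset.prod_pair (by positivity), Finset.prod_biUnion]
  · congr 1
    refine Finset.prod_congr rfl fun i _ => Finset.prod_image fun u _ v _ h => ?_
    exact mul_left_cancel₀ (pow_ne_zero _ (two_ne_zero (α := ℤ))) h
  · intro i hi k hk hik
    simp only [Finset.coe_Icc, Set.mem_Icc] at hi hk
    refine Finset.disjoint_left.2 fun t h₁ h₂ => hik ?_
    obtain ⟨u, hu, rfl⟩ := Finset.mem_image.1 h₁
    obtain ⟨v, hv, h⟩ := Finset.mem_image.1 h₂
    exact hinj hi.2 hk.2 (odd_of_mem_Dfin hu) (odd_of_mem_Dfin hv) h.symm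
  · refine Finset.disjoint_left.2 fun t h₁ h₂ => ?_
    simp only [Finset.mem_biUnion, Finset.mem_Icc, Finset.mem_image] at h₂
    obtain ⟨i, hi, u, hu, rfl⟩ := h₂
    have ho := odd_of_mem_Dfin hu
    rcases Finset.mem_insert.1 h₁ with h | h
    · have : u = 0 := by simpa using h
      simp [this] at ho
    · have := hinj (k := 1) hi.2 (by lia) ho odd_one (by simpa using h)
      lia

/-- The representative of the coset of `-t`, for a representative `t`. -/
def negRep (r : ℕ) (t : ℤ) : ℤ := if t = 2 ^ (r - 1) then t else -t

lemma negRep_mem {a r : ℕ} {t : ℤ} (ht : t ∈ cosetReps a r) : negRep r t ∈ cosetReps a r := by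
  unfold negRep
  split_ifs with h
  · exact ht
  · rcases mem_cosetReps.1 ht with rfl | rfl | ⟨i, hi, u, hu, rfl⟩
    · simpa using ht
    · exact absurd rfl h
    · exact mem_cosetReps.2 (Or.inr (Or.inr ⟨i, hi, -u, neg_mem_Dfin hu, by ring⟩))

lemma neg_two_pow_notMem (a r : ℕ) : -(2 : ℤ) ^ (r - 1) ∉ cosetReps a r := by
  intro h
  have hpos : (0 : ℤ) < 2 ^ (r - 1) := by positivity
  rcases mem_cosetReps.1 h with h | h | ⟨i, hi, u, hu, h⟩
  · lia
  · lia
  · have := two_pow_mul_odd_inj (l := r - 1) (v := -1) (odd_of_mem_Dfin hu) (by decide)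
      (by simpa using h)
    lia

lemma negRep_negRep {a r : ℕ} {t : ℤ} (ht : t ∈ cosetReps a r) : negRep r (negRep r t) = t := by
  have h : -t ≠ 2 ^ (r - 1) := by
    intro h
    exact neg_two_pow_notMem a r (by rwa [← h, neg_neg])
  unfold negRep
  split_ifs <;> simp_all

section Representatives

variable {a b r : ℕ}

lemma exists_cosetReps_modEq (ha : 2 ≤ a) (hr : 1 ≤ r) (hb : Odd b) (k : ℤ) :
    ∃ t ∈ cosetReps a r, ∃ e : ℕ, t * (2 ^ a * b + 1 : ℤ) ^ e ≡ k [ZMOD 2 ^ r] := by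
  by_cases hk : (2 : ℤ) ^ r ∣ k
  · exact ⟨0, mem_cosetReps.2 (Or.inl rfl), 0, by simpa using (Int.modEq_zero_iff_dvd.2 hk).symm⟩
  have hk0 : k ≠ 0 := by rintro rfl; simp at hk
  obtain ⟨w, hkw, hw⟩ := (Int.finiteMultiplicity_iff.2
    ⟨(by decide : Int.natAbs 2 ≠ 1), hk0⟩).exists_eq_pow_mul_and_not_dvd
  generalize multiplicity 2 k = l at hkw
  subst hkw
  rw [← even_iff_two_dvd, Int.not_even_iff_odd] at hw
  have hl : l < r := by
    by_contra! h
    exact hk ((pow_dvd_pow _ h).mul_right _)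
  obtain ⟨i, rfl⟩ : ∃ i, r = l + i := ⟨r - l, by lia⟩
  suffices H : ∃ u : ℤ, (i = 1 ∧ u = 1 ∨ 2 ≤ i ∧ u ∈ Dfin a i) ∧
      ∃ e : ℕ, u * (2 ^ a * b + 1 : ℤ) ^ e ≡ w [ZMOD 2 ^ i] by
    obtain ⟨u, hu, e, he⟩ := H
    refine ⟨2 ^ l * u, ?_, e, ?_⟩
    · rcases hu with ⟨rfl, rfl⟩ | ⟨hi, hu⟩
      · exact mem_cosetReps.2 (Or.inr (Or.inl (by simp)))
      · exact mem_cosetReps.2 (Or.inr (Or.inr ⟨i, ⟨hi, by lia⟩, u, hu, by simp⟩))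
    · rw [mul_assoc, pow_add]
      exact he.mul_left'
  rcases (by lia : i = 1 ∨ 2 ≤ i) with rfl | hi
  · exact ⟨1, Or.inl ⟨rfl, rfl⟩, 0, by simpa [Int.ModEq] using (Int.odd_iff.1 hw).symm⟩
  obtain ⟨u, hu, huw⟩ := exists_mem_Dfin_modEq ha hi hw
  refine ⟨u, Or.inr ⟨hi, hu⟩, ?_⟩
  rcases le_total i a with hia | hia
  · exact ⟨0, by simpa [min_eq_left hia] using huw⟩
  rw [min_eq_right hia] at huw
  obtain ⟨j, rfl⟩ := Nat.exists_eq_add_of_le hia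
  have hcop : IsCoprime u ((2 : ℤ) ^ (a + j)) :=
    (Int.isCoprime_two_right.2 (odd_of_mem_Dfin hu)).pow_right
  obtain ⟨c, d, hcd⟩ := hcop
  have hc : u * c ≡ 1 [ZMOD 2 ^ (a + j)] := Int.modEq_iff_dvd.2 ⟨d, by rw [← hcd]; ring⟩
  have hz : w * c ≡ 1 [ZMOD 2 ^ a] :=
    (huw.symm.mul_right c).trans (hc.of_dvd (pow_dvd_pow _ (by lia)))
  obtain ⟨e, -, he⟩ := exists_pow_modEq ha (b := (b : ℤ)) (by exact_mod_cast hb) rfl hz j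
  refine ⟨e, (he.mul_left u).trans ?_⟩
  have := hc.mul_left w
  rwa [mul_one, mul_left_comm] at this

lemma mem_cosetReps_cases (hr : 1 ≤ r) {t : ℤ} (ht : t ∈ cosetReps a r) :
    t = 0 ∨ ∃ i, 1 ≤ i ∧ i ≤ r ∧ ∃ u, Odd u ∧ t = 2 ^ (r - i) * u ∧
      (i = 1 ∧ u = 1 ∨ 2 ≤ i ∧ u ∈ Dfin a i) := by
  rcases mem_cosetReps.1 ht with rfl | rfl | ⟨i, hi, u, hu, rfl⟩
  · exact Or.inl rfl
  · exact Or.inr ⟨1, le_rfl, hr, 1, odd_one, by simp, Or.inl ⟨rfl, rfl⟩⟩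
  · exact Or.inr ⟨i, by lia, hi.2, u, odd_of_mem_Dfin hu, rfl, Or.inr ⟨hi.1, hu⟩⟩

lemma two_pow_dvd_two_pow_mul_odd {m n : ℕ} {u : ℤ} (hu : Odd u) :
    (2 : ℤ) ^ m ∣ 2 ^ n * u ↔ m ≤ n := by
  have hcop : IsCoprime ((2 : ℤ) ^ m) u := (Int.isCoprime_two_left.2 hu).pow_left
  rw [← pow_dvd_pow_iff (a := (2 : ℤ)) (by norm_num) (by decide)]
  exact ⟨hcop.dvd_of_dvd_mul_right, fun h => h.mul_right u⟩

end Representatives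

section Factorization

variable {F : Type*} [Field F] {E : Type*} [Field E] [Algebra F E] {β : E}

lemma IsPrimitiveRoot.zpow_eq_zpow_iff_modEq {G : Type*} [Field G] {ζ : G} {n : ℕ}
    (hζ : IsPrimitiveRoot ζ n) (hn : n ≠ 0) {k l : ℤ} : ζ ^ k = ζ ^ l ↔ k ≡ l [ZMOD n] := by
  have h0 : ζ ≠ 0 := by
    rintro rfl
    simpa [hn] using hζ.pow_eq_one
  rw [Int.modEq_comm, Int.modEq_iff_dvd, ← hζ.zpow_eq_one_iff_dvd, zpow_sub₀ h0,
    div_eq_one_iff_eq (zpow_ne_zero _ h0)]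

lemma aeval_eq_zero_of_minpoly_eq {x y : E} (h : minpoly F x = minpoly F y) {P : F[X]}
    (hx : aeval x P = 0) : aeval y P = 0 := by
  obtain ⟨Q, rfl⟩ := h ▸ minpoly.dvd F x hx
  simp

variable {a b r : ℕ}

lemma isIntegral_zpow (hβ : IsPrimitiveRoot β (2 ^ r)) (t : ℤ) : IsIntegral F (β ^ t) := by
  refine IsIntegral.of_pow (n := 2 ^ r) (by positivity) ?_
  rw [← zpow_natCast, zpow_comm, zpow_natCast β, hβ.pow_eq_one, one_zpow]
  exact isIntegral_one

variable [Fintype F]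

lemma mem_range_algebraMap_of_pow_card_eq {y : E} (hy : y ^ Fintype.card F = y) :
    ∃ c, algebraMap F E c = y := by
  classical
  have hne : (X ^ Fintype.card F - X : F[X]) ≠ 0 :=
    FiniteField.X_pow_card_sub_X_ne_zero F Fintype.one_lt_card
  have hsplit : (X ^ Fintype.card F - X : F[X]).Splits := by
    rw [splits_iff_card_roots, FiniteField.roots_X_pow_card_sub_X,
      FiniteField.X_pow_card_sub_X_natDegree_eq F Fintype.one_lt_card]
    rfl
  exact hsplit.mem_range_of_isRoot hne (by simp [hy])

lemma aeval_pow_card_pow_eq_zero {x : E} {P : F[X]} (h : aeval x P = 0) (e : ℕ) :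
    aeval (x ^ Fintype.card F ^ e) P = 0 := by
  induction e with
  | zero => simpa using h
  | succ e ih =>
    have := aeval_algHom_apply (FiniteField.frobeniusAlgHom F E) (x ^ Fintype.card F ^ e) P
    rw [ih, map_zero] at this
    rwa [pow_succ, pow_mul]

lemma minpoly_zpow_injOn (hβ : IsPrimitiveRoot β (2 ^ r)) (ha : 2 ≤ a) (hr : 1 ≤ r)
    (hq : Fintype.card F = 2 ^ a * b + 1) :
    Set.InjOn (fun t : ℤ => minpoly F (β ^ t)) (cosetReps a r) := by
  have h2r : 2 ^ r ≠ 0 := by positivity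
  have hroot {t t' : ℤ} (h : minpoly F (β ^ t) = minpoly F (β ^ t')) (n : ℕ)
      (hn : (2 : ℤ) ^ r ∣ t * n) : (2 : ℤ) ^ r ∣ t' * n := by
    have := aeval_eq_zero_of_minpoly_eq h (P := X ^ n - 1) (by
      rw [map_sub, map_pow, aeval_X, map_one, sub_eq_zero, ← zpow_natCast, ← zpow_mul,
        hβ.zpow_eq_one_iff_dvd]
      exact_mod_cast hn)
    rw [map_sub, map_pow, aeval_X, map_one, sub_eq_zero, ← zpow_natCast, ← zpow_mul,
      hβ.zpow_eq_one_iff_dvd] at this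
    exact_mod_cast this
  have hle {i i' : ℕ} (hi : i ≤ r) (hi' : i' ≤ r) {u u' : ℤ} (hu' : Odd u')
      (h : minpoly F (β ^ (2 ^ (r - i) * u)) = minpoly F (β ^ (2 ^ (r - i') * u'))) : i' ≤ i := by
    have := hroot h (2 ^ i) ⟨u, by
      rw [mul_right_comm]; push_cast; rw [← pow_add, Nat.sub_add_cancel hi]⟩
    rw [mul_right_comm] at this
    push_cast at this
    rw [← pow_add, two_pow_dvd_two_pow_mul_odd hu'] at this
    lia
  have hzero {i : ℕ} (hi : 1 ≤ i) (hir : i ≤ r) {u : ℤ} (hu : Odd u)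
      (h : minpoly F (β ^ (0 : ℤ)) = minpoly F (β ^ (2 ^ (r - i) * u))) : False := by
    have := hle (i := 0) (u := 0) (by lia) hir hu (by simpa using h)
    lia
  intro t ht t' ht' h
  simp only at h
  rcases mem_cosetReps_cases hr ht with rfl | ⟨i, hi, hir, u, hu, rfl, hui⟩ <;>
    rcases mem_cosetReps_cases hr ht' with rfl | ⟨i', hi', hir', u', hu', rfl, hui'⟩
  · rfl
  · exact (hzero hi' hir' hu' h).elim
  · exact (hzero hi hir hu h.symm).elim
  obtain rfl : i = i' := le_antisymm (hle hir' hir hu h.symm) (hle hir hir' hu' h)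
  rcases hui with ⟨rfl, rfl⟩ | ⟨hi2, hui⟩
  · rcases hui' with ⟨-, rfl⟩ | ⟨h2, -⟩
    · rfl
    · lia
  replace hui' : u' ∈ Dfin a i := by
    rcases hui' with ⟨rfl, -⟩ | ⟨-, h⟩
    · lia
    · exact h
  congr 1
  refine eq_of_mem_Dfin_of_modEq ha hi2 hui hui' ?_
  obtain ⟨d, hd⟩ : ∃ d, d = min i a := ⟨_, rfl⟩
  rw [← hd]
  obtain ⟨k, rfl⟩ : ∃ k, i = k + d := ⟨i - d, by lia⟩
  have hexp (v : ℤ) : (β ^ (2 ^ (r - (k + d)) * v)) ^ 2 ^ k = β ^ (2 ^ (r - d) * v) := by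
    rw [← zpow_natCast, ← zpow_mul, mul_right_comm]
    push_cast
    rw [← pow_add]
    congr 3
    lia
  obtain ⟨c, hc⟩ : ∃ c, algebraMap F E c = β ^ (2 ^ (r - d) * u) := by
    apply mem_range_algebraMap_of_pow_card_eq
    rw [← zpow_natCast, ← zpow_mul, hβ.zpow_eq_zpow_iff_modEq h2r, hq, Int.modEq_comm,
      Int.modEq_iff_dvd]
    refine ⟨u * (2 ^ (a - d) * b), ?_⟩
    push_cast
    have h1 : (2 : ℤ) ^ a = 2 ^ (a - d) * 2 ^ d := by rw [← pow_add]; congr 1; lia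
    have h2 : (2 : ℤ) ^ r = 2 ^ (r - d) * 2 ^ d := by rw [← pow_add]; congr 1; lia
    rw [h1, h2]; ring
  have := aeval_eq_zero_of_minpoly_eq h (P := X ^ 2 ^ k - C c) (by simp [hexp, hc])
  rw [map_sub, map_pow, aeval_X, aeval_C, hexp, hc, sub_eq_zero,
    hβ.zpow_eq_zpow_iff_modEq h2r] at this
  push_cast at this
  have h2 : (2 : ℤ) ^ r = 2 ^ (r - d) * 2 ^ d := by rw [← pow_add]; congr 1; lia
  rw [h2] at this
  exact (Int.ModEq.mul_left_cancel' (by positivity) this).symm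

lemma prod_minpoly_cosetReps (hβ : IsPrimitiveRoot β (2 ^ r)) (ha : 2 ≤ a) (hr : 1 ≤ r)
    (hb : Odd b) (hq : Fintype.card F = 2 ^ a * b + 1) :
    ∏ t ∈ cosetReps a r, minpoly F (β ^ t) = X ^ 2 ^ r - 1 := by
  have hint := isIntegral_zpow (F := F) hβ
  have hmonic : (X ^ 2 ^ r - 1 : F[X]).Monic := monic_X_pow_sub_C (1 : F) (by positivity)
  refine eq_of_monic_of_associated (monic_prod_of_monic _ _ fun t _ => minpoly.monic (hint t))
    hmonic (associated_of_dvd_dvd ?_ ?_)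
  · refine Finset.prod_dvd_of_coprime (fun t ht t' ht' hne => ?_) fun t _ => minpoly.dvd _ _ ?_
    · refine (minpoly.irreducible (hint t)).coprime_iff_not_dvd.2 fun h => hne ?_
      refine minpoly_zpow_injOn hβ ha hr hq ht ht' ?_
      exact eq_of_monic_of_associated (minpoly.monic (hint t)) (minpoly.monic (hint t'))
        ((minpoly.irreducible (hint t)).associated_of_dvd (minpoly.irreducible (hint t')) h)
    · rw [map_sub, map_pow, aeval_X, map_one, ← zpow_natCast, zpow_comm, zpow_natCast β,
        hβ.pow_eq_one, one_zpow, sub_self]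
  · rw [← map_dvd_map' (algebraMap F E)]
    simp only [Polynomial.map_sub, Polynomial.map_pow, map_X, Polynomial.map_one]
    rw [X_pow_sub_one_eq_prod (by positivity) hβ]
    refine Finset.prod_dvd_of_coprime (fun x _ y _ hxy => ?_) fun x hx => ?_
    · exact pairwise_coprime_X_sub_C Function.injective_id hxy
    · have hx : x ^ 2 ^ r = 1 := (mem_nthRootsFinset (by positivity) _).1 hx
      obtain ⟨k, -, rfl⟩ := hβ.eq_pow_of_pow_eq_one hx
      obtain ⟨t, ht, e, he⟩ := exists_cosetReps_modEq ha hr hb (k : ℤ)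
      rw [dvd_iff_isRoot, IsRoot, eval_map_algebraMap, map_prod]
      refine Finset.prod_eq_zero ht ?_
      have := aeval_pow_card_pow_eq_zero (minpoly.aeval F (β ^ t)) e
      convert! this using 3
      rw [← zpow_natCast, ← zpow_natCast, ← zpow_mul,
        hβ.zpow_eq_zpow_iff_modEq (by positivity), hq]
      push_cast
      exact he.symm

end Factorization

lemma span_singleton_eq_of_associated {R : Type*} [CommSemiring R] {x y : R}
    (h : Associated x y) : Ideal.span {x} = Ideal.span {y} :=
  le_antisymm (Ideal.span_singleton_le_span_singleton.2 h.symm.dvd)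
    (Ideal.span_singleton_le_span_singleton.2 h.dvd)

lemma associated_rootInvHom_mk_minpoly {F E : Type*} [Field F] [Field E] [Algebra F E] {N : ℕ}
    (hN : N ≠ 0) {x : E} (hx : IsIntegral F x) (h0 : x ≠ 0) :
    Associated (rootInvHom F N (AdjoinRoot.mk _ (minpoly F x)))
      (AdjoinRoot.mk _ (minpoly F x⁻¹)) :=
  (associated_rootInvHom_mk hN _).trans ((associated_minpoly_inv hx h0).map (AdjoinRoot.mk _))

lemma zpow_negRep {E : Type*} [Field E] {β : E} {r : ℕ} (hβ : IsPrimitiveRoot β (2 ^ r))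
    (hr : 1 ≤ r) (t : ℤ) : β ^ negRep r t = (β ^ t)⁻¹ := by
  unfold negRep
  split_ifs with h
  · refine eq_inv_of_mul_eq_one_left ?_
    rw [h, ← zpow_add₀ (hβ.ne_zero (by positivity)), hβ.zpow_eq_one_iff_dvd]
    refine ⟨1, ?_⟩
    push_cast
    rw [← two_mul, mul_pow_sub_one (by lia), mul_one]
  · rw [zpow_neg]

/-- for `q = p^m = 2^a·b+1`, the dual of the cyclic code of length `2^r·p^s`
generated by `m_0^{j_0}·m_{2^{r−1}}^{j_{2^{r−1}}}·∏_{i=2}^r ∏_{u∈D_i} m_{2^{r−i}u}^{j_{2^{r−i}u}}`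
is the cyclic code generated by
`m_0^{p^s−j_0}·m_{2^{r−1}}^{p^s−j_{2^{r−1}}}·∏_{i=2}^r ∏_{u∈D_i} m_{2^{r−i}u}^{p^s−j_{2^{r−i}(−u)}}`. -/
theorem stmt7 (p m a b r s : ℕ) (hp : p.Prime) (hpodd : Odd p) (hm : 0 < m) (hs : 0 < s)
    (hb : Odd b) (ha : 2 ≤ a) (hr : 2 ≤ r) (hq : p ^ m = 2 ^ a * b + 1)
    (F : Type*) [Field F] [Fintype F] (hF : Fintype.card F = p ^ m)
    (E : Type*) [Field E] [Algebra F E] (β : E) (hβ : IsPrimitiveRoot β (2 ^ r))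
    (N : ℕ) (hN : N = 2 ^ r * p ^ s) (hf : (X ^ N - 1 : Polynomial F) ≠ 0)
    (j : ℤ → ℕ) (hj : ∀ t ∈ ({0, 2 ^ (r - 1)} : Finset ℤ) ∪
      (Finset.Icc 2 r).biUnion (fun i => (Dfin a i).image fun u => 2 ^ (r - i) * u), j t ≤ p ^ s)
    (C : Ideal (AdjoinRoot (X ^ N - 1 : Polynomial F)))
    (hC : C = Ideal.span {AdjoinRoot.mk (X ^ N - 1 : Polynomial F)
      (minpoly F (β ^ (0 : ℤ)) ^ j 0 *
        minpoly F (β ^ ((2 : ℤ) ^ (r - 1))) ^ j (2 ^ (r - 1)) *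
        ∏ i ∈ Finset.Icc 2 r, ∏ u ∈ Dfin a i,
          minpoly F (β ^ ((2 : ℤ) ^ (r - i) * u)) ^ j (2 ^ (r - i) * u))}) :
    dualCode hf C = ↑(Ideal.span {AdjoinRoot.mk (X ^ N - 1 : Polynomial F)
      (minpoly F (β ^ (0 : ℤ)) ^ (p ^ s - j 0) *
        minpoly F (β ^ ((2 : ℤ) ^ (r - 1))) ^ (p ^ s - j (2 ^ (r - 1))) *
        ∏ i ∈ Finset.Icc 2 r, ∏ u ∈ Dfin a i,
          minpoly F (β ^ ((2 : ℤ) ^ (r - i) * u)) ^ (p ^ s - j (2 ^ (r - i) * (-u))))}) := by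
  have hr1 : 1 ≤ r := by lia
  have hN0 : N ≠ 0 := by rintro rfl; simp at hf
  have hint := isIntegral_zpow (F := F) hβ
  have hβ0 : β ≠ 0 := hβ.ne_zero (by positivity)
  have : Fact p.Prime := ⟨hp⟩
  have : CharP F p := charP_of_card_eq_prime_pow hF
  set μ : ℤ → F[X] := fun t => minpoly F (β ^ t) with hμ
  have hG : ∏ t ∈ cosetReps a r, μ t ^ j t =
      minpoly F (β ^ (0 : ℤ)) ^ j 0 *
        minpoly F (β ^ ((2 : ℤ) ^ (r - 1))) ^ j (2 ^ (r - 1)) *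
        ∏ i ∈ Finset.Icc 2 r, ∏ u ∈ Dfin a i,
          minpoly F (β ^ ((2 : ℤ) ^ (r - i) * u)) ^ j (2 ^ (r - i) * u) :=
    prod_cosetReps _
  have hH : ∏ t ∈ cosetReps a r, μ t ^ (p ^ s - j (negRep r t)) =
      minpoly F (β ^ (0 : ℤ)) ^ (p ^ s - j 0) *
        minpoly F (β ^ ((2 : ℤ) ^ (r - 1))) ^ (p ^ s - j (2 ^ (r - 1))) *
        ∏ i ∈ Finset.Icc 2 r, ∏ u ∈ Dfin a i,
          minpoly F (β ^ ((2 : ℤ) ^ (r - i) * u)) ^ (p ^ s - j (2 ^ (r - i) * (-u))) := by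
    rw [prod_cosetReps]
    have h0 : negRep r 0 = 0 := by simp [negRep]
    have h1 : negRep r (2 ^ (r - 1)) = 2 ^ (r - 1) := by simp [negRep]
    rw [h0, h1]
    congr 1
    refine Finset.prod_congr rfl fun i hi => Finset.prod_congr rfl fun u hu => ?_
    rw [Finset.mem_Icc] at hi
    have h2 : (2 : ℤ) ^ (r - i) * u ≠ 2 ^ (r - 1) := fun h => by
      have := two_pow_mul_odd_inj (l := r - 1) (v := 1) (odd_of_mem_Dfin hu) odd_one
        (by simpa using h)
      lia
    rw [negRep, if_neg h2, mul_neg]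
  have hGH : (∏ t ∈ cosetReps a r, μ t ^ j t) * ∏ t ∈ cosetReps a r, μ t ^ (p ^ s - j t) =
      X ^ N - 1 := by
    rw [← Finset.prod_mul_distrib, hN, pow_mul,
      ← one_pow (p ^ s), ← sub_pow_char_pow (p := p), ← prod_minpoly_cosetReps hβ ha hr1 hb
        (hF.trans hq), ← Finset.prod_pow]
    refine Finset.prod_congr rfl fun t ht => ?_
    rw [← pow_add, Nat.add_sub_cancel' (hj t ht)]
  rw [← hG] at hC
  rw [hC, dualCode_span_singleton hf hGH, ← hH, SetLike.coe_set_eq]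
  refine span_singleton_eq_of_associated ?_
  have hreindex : ∏ t ∈ cosetReps a r, μ t ^ (p ^ s - j (negRep r t)) =
      ∏ t ∈ cosetReps a r, μ (negRep r t) ^ (p ^ s - j t) :=
    Finset.prod_nbij' (negRep r) (negRep r) (fun _ => negRep_mem) (fun _ => negRep_mem)
      (fun _ => negRep_negRep) (fun _ => negRep_negRep) fun t ht => by rw [negRep_negRep ht]
  rw [hreindex, map_prod, map_prod, map_prod]
  refine Associated.prod _ _ _ fun t _ => ?_
  rw [map_pow, map_pow, map_pow]
  refine Associated.pow_pow ?_
  simp only [hμ]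
  rw [zpow_negRep hβ hr1]
  exact associated_rootInvHom_mk_minpoly hN0 (hint t) (zpow_ne_zero _ hβ0)
end

section
/- Let p be an odd prime, q = p^m with q = 2^a·b − 1, b odd, a = 2, let r ≥ 3, and N = 2^r·p^s. Let C be the ideal of R = F_q[x]/(x^N − 1) generated by m_0(x)^{j_0} · m_{2^{r−1}}(x)^{j_{2^{r−1}}} · m_{2^{r−2}}(x)^{j_{2^{r−2}}} · ∏_{i=3}^r ∏_{s ∈ O_i} m_{2^{r−i}s}(x)^{j_{2^{r−i}s}}, where 0 ≤ j_t ≤ p^s for each t ∈ T_n. Then C^⊥ is the ideal of R generated by m_0(x)^{p^s−j_0} · m_{2^{r−1}}(x)^{p^s−j_{2^{r−1}}} · m_{2^{r−2}}(x)^{p^s−j_{2^{r−2}}} · ∏_{i=3}^r ∏_{s ∈ O_i} m_{2^{r−i}s}(x)^{p^s−j_{2^{r−i}(−s)}}, where for s ∈ O_i = {1, −1} the element −s also lies in O_i and j_{2^{r−i}(−s)} is the exponent attached to the representative 2^{r−i}·(−s). -/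
open Polynomial

namespace CyclicCode

variable {F : Type*} [Field F] {N : ℕ}

theorem root_pow_length : AdjoinRoot.root (X ^ N - 1 : F[X]) ^ N = 1 := by
  have h := AdjoinRoot.eval₂_root (X ^ N - 1 : F[X])
  simpa [sub_eq_zero] using h

/-- The involution `x ↦ x⁻¹` of `F[x]/(x^N - 1)`. -/
noncomputable def inversion (F : Type*) [Field F] (N : ℕ) :
    AdjoinRoot (X ^ N - 1 : F[X]) →ₐ[F] AdjoinRoot (X ^ N - 1 : F[X]) :=
  AdjoinRoot.liftAlgHom _ (Algebra.ofId _ _) (AdjoinRoot.root _ ^ (N - 1)) (by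
    rw [eval₂_sub, eval₂_X_pow, eval₂_one, pow_right_comm, root_pow_length, one_pow, sub_self])

theorem inversion_root :
    inversion F N (AdjoinRoot.root _) = AdjoinRoot.root _ ^ (N - 1) :=
  AdjoinRoot.liftAlgHom_root _ _ _ _

theorem root_mul_inversion_root (hN : 0 < N) :
    AdjoinRoot.root _ * inversion F N (AdjoinRoot.root _) = 1 := by
  rw [inversion_root, ← pow_succ', Nat.sub_add_cancel hN, root_pow_length]

theorem inversion_inversion (hN : 0 < N) (x : AdjoinRoot (X ^ N - 1 : F[X])) :
    inversion F N (inversion F N x) = x := by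
  suffices h : (inversion F N).comp (inversion F N) = AlgHom.id F _ from
    DFunLike.congr_fun h x
  apply AdjoinRoot.algHom_ext
  have h1 := root_mul_inversion_root (F := F) hN
  have h2 := congrArg (inversion F N) h1
  rw [map_mul, map_one] at h2
  rw [AlgHom.comp_apply, AlgHom.id_apply]
  calc _ = (AdjoinRoot.root _ * inversion F N (AdjoinRoot.root _)) *
        inversion F N (inversion F N (AdjoinRoot.root _)) := by rw [h1, one_mul]
    _ = _ := by rw [mul_assoc, h2, mul_one]

section Pairing

variable (hf : (X ^ N - 1 : F[X]) ≠ 0)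

theorem powerBasis_dim_eq : (AdjoinRoot.powerBasis hf).dim = N := by
  rw [AdjoinRoot.powerBasis_dim, ← C_1, natDegree_X_pow_sub_C]

theorem coeffRepr_root_pow (e : ℕ) (i : Fin (AdjoinRoot.powerBasis hf).dim) (hN : 0 < N) :
    coeffRepr hf (AdjoinRoot.root _ ^ e) i = if e % N = i then 1 else 0 := by
  have he : e % N < (AdjoinRoot.powerBasis hf).dim := by
    rw [powerBasis_dim_eq]; exact Nat.mod_lt _ hN
  have h : AdjoinRoot.root (X ^ N - 1 : F[X]) ^ e =
      (AdjoinRoot.powerBasis hf).basis ⟨e % N, he⟩ := by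
    rw [PowerBasis.basis_eq_pow, AdjoinRoot.powerBasis_gen]
    conv_lhs => rw [← Nat.mod_add_div e N, pow_add, pow_mul, root_pow_length, one_pow, mul_one]
  rw [coeffRepr, h, Module.Basis.repr_self, Finsupp.single_apply]
  simp [Fin.ext_iff]

theorem coeffRepr_mul_inversion_basis (i k : Fin (AdjoinRoot.powerBasis hf).dim)
    (hN : 0 < N) (h0 : 0 < (AdjoinRoot.powerBasis hf).dim) :
    coeffRepr hf ((AdjoinRoot.powerBasis hf).basis i *
      inversion F N ((AdjoinRoot.powerBasis hf).basis k)) ⟨0, h0⟩ = if i = k then 1 else 0 := by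
  rw [PowerBasis.basis_eq_pow, PowerBasis.basis_eq_pow, AdjoinRoot.powerBasis_gen, map_pow,
    inversion_root, ← pow_mul, ← pow_add, coeffRepr_root_pow hf _ _ hN]
  have hi := i.2
  have hk := k.2
  simp only [powerBasis_dim_eq] at hi hk
  congr 1
  rw [Fin.ext_iff, eq_iff_iff, ← Nat.dvd_iff_mod_eq_zero]
  have key : N ∣ (i : ℕ) + (N - 1) * k ↔ (N : ℤ) ∣ (i : ℤ) - k := by
    rw [← Int.natCast_dvd_natCast]
    push_cast [Nat.cast_sub hN]
    have : ((i : ℕ) : ℤ) + (N - 1) * (k : ℕ) = ((i : ℕ) - (k : ℕ)) + N * (k : ℕ) := by ring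
    rw [this]
    exact dvd_add_left (dvd_mul_right _ _)
  rw [key]
  refine ⟨fun h => ?_, fun h => by simp [h]⟩
  have := Int.eq_zero_of_abs_lt_dvd h (by rw [abs_lt]; omega)
  omega

/-- The Euclidean inner product of `x` and `y` is the constant coefficient of `x(X) y(X⁻¹)`. -/
theorem sum_coeffRepr_mul (hN : 0 < N) (h0 : 0 < (AdjoinRoot.powerBasis hf).dim)
    (x y : AdjoinRoot (X ^ N - 1 : F[X])) :
    ∑ i, coeffRepr hf x i * coeffRepr hf y i =
      coeffRepr hf (x * inversion F N y) ⟨0, h0⟩ := by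
  have hx : x = ∑ i, coeffRepr hf x i • (AdjoinRoot.powerBasis hf).basis i :=
    ((AdjoinRoot.powerBasis hf).basis.sum_repr x).symm
  have hy : y = ∑ i, coeffRepr hf y i • (AdjoinRoot.powerBasis hf).basis i :=
    ((AdjoinRoot.powerBasis hf).basis.sum_repr y).symm
  have hmul : x * inversion F N y = ∑ i, ∑ k, (coeffRepr hf x i * coeffRepr hf y k) •
      ((AdjoinRoot.powerBasis hf).basis i *
        inversion F N ((AdjoinRoot.powerBasis hf).basis k)) := by
    conv_lhs => rw [hx, hy]
    rw [map_sum, Finset.sum_mul_sum]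
    simp only [map_smul, smul_mul_smul_comm]
  have hcoord : ∀ z, coeffRepr hf z ⟨0, h0⟩ =
      (AdjoinRoot.powerBasis hf).basis.coord ⟨0, h0⟩ z := fun _ => rfl
  rw [hmul, hcoord]
  simp only [map_sum, map_smul]
  simp only [← hcoord, coeffRepr_mul_inversion_basis hf _ _ hN h0]
  simp

theorem mem_dualCode_span_singleton (hN : 0 < N) (g x : AdjoinRoot (X ^ N - 1 : F[X])) :
    x ∈ dualCode hf (Ideal.span {g}) ↔ x * inversion F N g = 0 := by
  have h0 : 0 < (AdjoinRoot.powerBasis hf).dim := by rwa [powerBasis_dim_eq]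
  constructor
  · intro hx
    apply (AdjoinRoot.powerBasis hf).basis.repr.injective
    ext i
    have h1 := hx (g * (AdjoinRoot.powerBasis hf).basis i)
      (Ideal.mul_mem_right _ _ (Ideal.mem_span_singleton_self g))
    rw [sum_coeffRepr_mul hf hN h0, map_mul, ← mul_assoc, ← sum_coeffRepr_mul hf hN h0] at h1
    simp only [coeffRepr, Module.Basis.repr_self] at h1
    simpa [Finsupp.single_apply, -AdjoinRoot.powerBasis_dim] using h1
  · intro hx y hy
    obtain ⟨a, rfl⟩ := Ideal.mem_span_singleton'.1 hy
    rw [sum_coeffRepr_mul hf hN h0, map_mul, mul_left_comm, hx, mul_zero]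
    simp [coeffRepr]

/-- The dual of the cyclic code generated by `g` is generated by the reciprocal of the check
polynomial `h`, where `g * h = X ^ N - 1`. -/
theorem dualCode_span_singleton (hN : 0 < N) {g h : F[X]} (hgh : g * h = X ^ N - 1) :
    dualCode hf (Ideal.span {AdjoinRoot.mk _ g}) =
      ↑(Ideal.span {inversion F N (AdjoinRoot.mk _ h)}) := by
  ext x
  rw [mem_dualCode_span_singleton hf hN, SetLike.mem_coe, Ideal.mem_span_singleton]
  have hg : g ≠ 0 := by
    rintro rfl
    exact hf (by rw [← hgh, zero_mul])
  obtain ⟨z, hz⟩ := AdjoinRoot.mk_surjective (inversion F N x)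
  have hx : x = inversion F N (AdjoinRoot.mk _ z) := by rw [hz, inversion_inversion hN]
  have hinj : Function.Injective (inversion F N) :=
    Function.LeftInverse.injective (inversion_inversion hN)
  rw [hx, ← map_mul, map_eq_zero_iff _ hinj]
  constructor
  · intro h0
    rw [← map_mul, AdjoinRoot.mk_eq_zero] at h0
    have h1 : g * h ∣ g * z := by rw [hgh, mul_comm g z]; exact h0
    exact _root_.map_dvd _ (_root_.map_dvd _ ((mul_dvd_mul_iff_left hg).1 h1))
  · rintro ⟨w, hw⟩
    have h1 := congrArg (inversion F N) hw
    rw [map_mul, inversion_inversion hN, inversion_inversion hN] at h1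
    rw [h1, mul_right_comm, ← map_mul, mul_comm h g, hgh, AdjoinRoot.mk_self, zero_mul]

end Pairing

/-- The polynomials `a` and `b` are reciprocal up to units modulo `X ^ N - 1`. -/
def IsReciprocal (N : ℕ) (a b : F[X]) : Prop :=
  Ideal.span {inversion F N (AdjoinRoot.mk _ a)} = Ideal.span {AdjoinRoot.mk _ b}

theorem IsReciprocal.mul {a b c d : F[X]} (h₁ : IsReciprocal N a b) (h₂ : IsReciprocal N c d) :
    IsReciprocal N (a * c) (b * d) := by
  unfold IsReciprocal at *
  rw [map_mul, map_mul, map_mul, ← Ideal.span_singleton_mul_span_singleton, h₁, h₂,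
    Ideal.span_singleton_mul_span_singleton]

theorem IsReciprocal.pow {a b : F[X]} (h : IsReciprocal N a b) (k : ℕ) :
    IsReciprocal N (a ^ k) (b ^ k) := by
  unfold IsReciprocal at *
  rw [map_pow, map_pow, map_pow, ← Ideal.span_singleton_pow, h, Ideal.span_singleton_pow]

theorem IsReciprocal.prod {ι : Type*} (t : Finset ι) {a b : ι → F[X]}
    (h : ∀ i ∈ t, IsReciprocal N (a i) (b i)) :
    IsReciprocal N (∏ i ∈ t, a i) (∏ i ∈ t, b i) := by
  classical
  induction t using Finset.induction_on with
  | empty => simp [IsReciprocal]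
  | insert i t hi ih =>
    rw [Finset.prod_insert hi, Finset.prod_insert hi]
    exact (h i (Finset.mem_insert_self i t)).mul
      (ih fun k hk => h k (Finset.mem_insert_of_mem hk))

variable {E : Type*} [Field E] [Algebra F E]

theorem mk_minpoly_inv_dvd (hN : 0 < N) {y : E} (hy : y ≠ 0) :
    AdjoinRoot.mk (X ^ N - 1) (minpoly F y⁻¹) ∣
      inversion F N (AdjoinRoot.mk _ (minpoly F y)) := by
  let : Invertible y := invertibleOfNonzero hy
  have h1 : minpoly F y⁻¹ ∣ (minpoly F y).reverse := by
    apply minpoly.dvd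
    rw [aeval_def, ← invOf_eq_inv, eval₂_reverse_eq_zero_iff]
    exact minpoly.aeval F y
  let : Invertible (inversion F N (AdjoinRoot.root _)) :=
    ⟨AdjoinRoot.root _, root_mul_inversion_root hN,
      by rw [mul_comm]; exact root_mul_inversion_root hN⟩
  have h2 : inversion F N (AdjoinRoot.mk _ (minpoly F y)) =
      AdjoinRoot.mk _ (minpoly F y).reverse *
        inversion F N (AdjoinRoot.root _) ^ (minpoly F y).natDegree := by
    rw [← AdjoinRoot.aeval_eq, ← AdjoinRoot.aeval_eq, ← aeval_algHom_apply]
    exact (eval₂_reverse_mul_pow (algebraMap F _) (inversion F N (AdjoinRoot.root _))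
      (minpoly F y)).symm
  rw [h2]
  exact (_root_.map_dvd _ h1).mul_right _

theorem isReciprocal_minpoly_inv (hN : 0 < N) {y : E} (hy : y ≠ 0) :
    IsReciprocal N (minpoly F y) (minpoly F y⁻¹) := by
  apply le_antisymm
  · rw [Ideal.span_singleton_le_span_singleton]
    exact mk_minpoly_inv_dvd hN hy
  · rw [Ideal.span_singleton_le_span_singleton]
    have h := _root_.map_dvd (inversion F N) (mk_minpoly_inv_dvd (F := F) hN (inv_ne_zero hy))
    rwa [inv_inv, inversion_inversion hN] at h

end CyclicCode

section Cyclotomic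

variable {F : Type*} [Field F] [Fintype F] {E : Type*} [Field E] [Algebra F E]

theorem IsPrimitiveRoot.dvd_card_pow_natDegree_minpoly_sub_one {γ : E} {k : ℕ} (hk : 0 < k)
    (hγ : IsPrimitiveRoot γ k) :
    k ∣ Fintype.card F ^ (minpoly F γ).natDegree - 1 := by
  have hint : IsIntegral F γ := (hγ.isIntegral hk).tower_top
  have : FiniteDimensional F (IntermediateField.adjoin F {γ}) :=
    IntermediateField.adjoin.finiteDimensional hint
  have : Finite (IntermediateField.adjoin F {γ}) := Module.finite_of_finite F
  have := Fintype.ofFinite (IntermediateField.adjoin F {γ})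
  have hcard := Module.card_eq_pow_finrank (K := F) (V := IntermediateField.adjoin F {γ})
  rw [IntermediateField.adjoin.finrank hint] at hcard
  rw [← hcard]
  apply hγ.dvd_of_pow_eq_one
  have h1 := FiniteField.pow_card_sub_one_eq_one (IntermediateField.AdjoinSimple.gen F γ) (by
    intro h
    have := congrArg (algebraMap _ E) h
    rw [IntermediateField.AdjoinSimple.algebraMap_gen, map_zero] at this
    exact hγ.ne_zero hk.ne' this)
  have h2 := congrArg (algebraMap _ E) h1
  rwa [map_pow, IntermediateField.AdjoinSimple.algebraMap_gen, map_one] at h2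

variable {b : ℤ}

theorem two_pow_le_of_dvd_pow_sub_one {q d n : ℕ} (hb : Odd b) (hq : (q : ℤ) = 4 * b - 1)
    (hd : d ≠ 0) (h : 2 ^ (n + 2) ∣ q ^ d - 1) : 2 ^ n ≤ d := by
  have hq0 : 1 ≤ q := by omega
  have hz : ((2 : ℤ) ^ (n + 2)) ∣ (q : ℤ) ^ d - 1 := by
    have := Int.natCast_dvd_natCast.2 h
    rwa [Nat.cast_sub (Nat.one_le_pow _ _ hq0), Nat.cast_pow, Nat.cast_pow, Nat.cast_one,
      Nat.cast_ofNat] at this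
  have hdeven : Even d := by
    by_contra hodd
    rw [Nat.not_even_iff_odd] at hodd
    have h4 : (4 : ℤ) ∣ (q : ℤ) ^ d - 1 :=
      dvd_trans ⟨2 ^ n, by rw [pow_add]; ring⟩ hz
    have h4' : (4 : ℤ) ∣ (q : ℤ) ^ d - (-1) ^ d :=
      dvd_trans ⟨b, by rw [hq]; ring⟩ (sub_dvd_pow_sub_pow (q : ℤ) (-1) d)
    rw [hodd.neg_one_pow] at h4'
    omega
  have hord := ZMod.orderOf_one_add_four_mul (-b) hb.neg n
  have hpow : (1 + 4 * ((-b : ℤ) : ZMod (2 ^ (n + 2)))) ^ d = 1 := by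
    have h1 : (1 + 4 * ((-b : ℤ) : ZMod (2 ^ (n + 2)))) = ((-(q : ℤ) : ℤ) : ZMod (2 ^ (n + 2))) := by
      rw [hq]; push_cast; ring
    rw [h1, ← Int.cast_pow, hdeven.neg_pow, ← sub_eq_zero, ← Int.cast_one, ← Int.cast_sub,
      ZMod.intCast_zmod_eq_zero_iff_dvd]
    exact_mod_cast hz
  exact Nat.le_of_dvd (Nat.pos_of_ne_zero hd) (hord ▸ orderOf_dvd_of_pow_eq_one hpow)

theorem IsPrimitiveRoot.two_pow_le_natDegree_minpoly (hb : Odd b)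
    (hq : (Fintype.card F : ℤ) = 4 * b - 1) {γ : E} {n : ℕ}
    (hγ : IsPrimitiveRoot γ (2 ^ (n + 2))) : 2 ^ n ≤ (minpoly F γ).natDegree := by
  have hpos : 0 < 2 ^ (n + 2) := by positivity
  exact two_pow_le_of_dvd_pow_sub_one hb hq
    (minpoly.natDegree_pos ((hγ.isIntegral hpos).tower_top)).ne'
    (hγ.dvd_card_pow_natDegree_minpoly_sub_one hpos)

theorem IsPrimitiveRoot.minpoly_eq_of_sub_eq (hb : Odd b)
    (hq : (Fintype.card F : ℤ) = 4 * b - 1) {γ : E} {n : ℕ}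
    (hγ : IsPrimitiveRoot γ (2 ^ (n + 3))) {c : F}
    (hc : γ ^ (2 * 2 ^ n) - algebraMap F E c * γ ^ 2 ^ n - 1 = 0) :
    minpoly F γ = X ^ (2 * 2 ^ n) - C c * X ^ 2 ^ n - 1 := by
  have hint : IsIntegral F γ := (hγ.isIntegral (by positivity)).tower_top
  have h1 : 1 ≤ 2 ^ n := Nat.one_le_two_pow
  have hdeg : (C c * X ^ 2 ^ n + 1 : F[X]).degree < ((2 * 2 ^ n : ℕ) : WithBot ℕ) := by
    refine (degree_add_le _ _).trans_lt (max_lt ?_ ?_)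
    · exact (degree_C_mul_X_pow_le _ _).trans_lt (by exact_mod_cast (by omega))
    · rw [degree_one]; exact_mod_cast (by omega)
  have hsub : (X ^ (2 * 2 ^ n) - C c * X ^ 2 ^ n - 1 : F[X]) =
    X ^ (2 * 2 ^ n) - (C c * X ^ 2 ^ n + 1) := by ring
  have hmonic : (X ^ (2 * 2 ^ n) - C c * X ^ 2 ^ n - 1 : F[X]).Monic := by
    rw [hsub]; exact monic_X_pow_sub hdeg
  have hnat : (X ^ (2 * 2 ^ n) - C c * X ^ 2 ^ n - 1 : F[X]).natDegree = 2 * 2 ^ n := by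
    rw [hsub]
    apply natDegree_eq_of_degree_eq_some
    rw [degree_sub_eq_left_of_degree_lt (by rwa [degree_X_pow]), degree_X_pow]
  refine (eq_of_dvd_of_natDegree_le_of_leadingCoeff (minpoly.dvd F γ ?_) ?_ ?_)
  · simpa using hc
  · rw [hnat]
    have := IsPrimitiveRoot.two_pow_le_natDegree_minpoly (F := F) (n := n + 1) hb hq hγ
    rwa [pow_succ'] at this
  · rw [(minpoly.monic hint).leadingCoeff, hmonic.leadingCoeff]

theorem IsPrimitiveRoot.minpoly_mul_minpoly_inv (hb : Odd b)
    (hq : (Fintype.card F : ℤ) = 4 * b - 1) {γ : E} {n : ℕ}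
    (hγ : IsPrimitiveRoot γ (2 ^ (n + 3))) :
    minpoly F γ * minpoly F γ⁻¹ = X ^ 2 ^ (n + 2) + 1 := by
  have hγ0 : γ ≠ 0 := hγ.ne_zero (by positivity)
  have hζ : IsPrimitiveRoot (γ ^ 2 ^ n) 8 :=
    hγ.pow (by positivity) (by rw [pow_add]; norm_num)
  have hζ4 : (γ ^ 2 ^ n) ^ 4 = -1 := by
    have h1 : (γ ^ 2 ^ n) ^ 4 ≠ 1 := hζ.pow_ne_one_of_pos_of_lt (by norm_num) (by norm_num)
    have h2 : ((γ ^ 2 ^ n) ^ 4 - 1) * ((γ ^ 2 ^ n) ^ 4 + 1) = 0 := by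
      linear_combination hζ.pow_eq_one
    exact eq_neg_of_add_eq_zero_left ((mul_eq_zero.1 h2).resolve_left (sub_ne_zero.2 h1))
  obtain ⟨d, hd⟩ : IsSquare (-2 : F) := by
    rw [FiniteField.isSquare_neg_two_iff]
    obtain ⟨t, rfl⟩ := hb
    omega
  have hdE : algebraMap F E d ^ 2 = -2 := by
    rw [← map_pow, sq, ← hd, map_neg, map_ofNat]
  obtain ⟨c, hc2, hc⟩ : ∃ c : F, c ^ 2 = -2 ∧
      (γ ^ 2 ^ n) + (γ ^ 2 ^ n) ^ 3 = algebraMap F E c := by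
    have : ((γ ^ 2 ^ n) + (γ ^ 2 ^ n) ^ 3) ^ 2 = algebraMap F E d ^ 2 := by
      rw [hdE]
      linear_combination (2 + (γ ^ 2 ^ n) ^ 2) * hζ4
    rcases sq_eq_sq_iff_eq_or_eq_neg.1 this with h | h
    · exact ⟨d, by rw [sq, ← hd], h⟩
    · exact ⟨-d, by rw [neg_sq, sq, ← hd], by rw [h, map_neg]⟩
  have e1 : (γ ^ 2 ^ n) ^ 2 - algebraMap F E c * γ ^ 2 ^ n - 1 = 0 := by
    rw [← hc]; linear_combination - hζ4
  rw [hγ.minpoly_eq_of_sub_eq hb hq (c := c) (by rw [mul_comm 2, pow_mul]; exact e1),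
    hγ.inv.minpoly_eq_of_sub_eq hb hq (c := -c) (by
      rw [mul_comm 2, pow_mul, inv_pow, map_neg]
      field_simp
      linear_combination -e1)]
  have hC : (C c : F[X]) ^ 2 = -2 := by
    rw [← C_pow, hc2, map_neg, map_ofNat]
  have hX : (X : F[X]) ^ 2 ^ (n + 2) = (X ^ 2 ^ n) ^ 4 := by
    rw [← pow_mul, pow_add]; norm_num
  rw [hX, mul_comm 2, pow_mul, map_neg]
  linear_combination -(X ^ 2 ^ n) ^ 2 * hC

theorem minpoly_of_sq_eq_neg_one (hq : Fintype.card F % 4 = 3) {y : E} (hy : y ^ 2 = -1) :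
    minpoly F y = X ^ 2 + 1 := by
  have haeval : aeval y (X ^ 2 + 1 : F[X]) = 0 := by simp [hy]
  have hmonic : (X ^ 2 + 1 : F[X]).Monic := by monicity!
  have hint : IsIntegral F y := ⟨X ^ 2 + 1, hmonic, haeval⟩
  refine eq_of_dvd_of_natDegree_le_of_leadingCoeff (minpoly.dvd F y haeval) ?_ ?_
  · have h2 : (X ^ 2 + 1 : F[X]).natDegree = 2 := by compute_degree!
    rw [h2, minpoly.two_le_natDegree_iff hint]
    rintro ⟨c, rfl⟩
    have hc : c ^ 2 = -1 := by
      apply (algebraMap F E).injective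
      simpa using hy
    exact FiniteField.isSquare_neg_one_iff.1 ⟨c, by rw [← hc, sq]⟩ hq
  · rw [(minpoly.monic hint).leadingCoeff, hmonic.leadingCoeff]

end Cyclotomic

theorem X_pow_two_pow_sub_one_eq_prod {R : Type*} [CommRing R] {r : ℕ} (hr : 2 ≤ r) :
    (X ^ 2 ^ r - 1 : R[X]) =
      (X - 1) * (X + 1) * (X ^ 2 + 1) * ∏ i ∈ Finset.Icc 3 r, (X ^ 2 ^ (i - 1) + 1) := by
  induction r, hr using Nat.le_induction with
  | base => simp; ring
  | succ r hr ih =>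
    rw [Finset.prod_Icc_succ_top (by omega), ← mul_assoc, ← ih, Nat.add_sub_cancel, pow_succ 2 r,
      pow_mul]
    ring

/-- for `q = p^m = 2^2·b−1` (`a = 2`, so `O_i = {1,−1}`), the dual of the
cyclic code of length `2^r·p^s` generated by
`m_0^{j_0}·m_{2^{r−1}}^{j_{2^{r−1}}}·m_{2^{r−2}}^{j_{2^{r−2}}}·∏_{i=3}^r ∏_{u∈O_i} m_{2^{r−i}u}^{j_{2^{r−i}u}}`
is the cyclic code generated by the corresponding product with exponents
`p^s − j_0`, `p^s − j_{2^{r−1}}`, `p^s − j_{2^{r−2}}` and `p^s − j_{2^{r−i}(−u)}`. -/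
theorem stmt8 (p m a b r s : ℕ) (hp : p.Prime) (hpodd : Odd p) (hm : 0 < m) (hs : 0 < s)
    (hb : Odd b) (ha : a = 2) (hr : 3 ≤ r) (hq : (p : ℤ) ^ m = 2 ^ a * b - 1)
    (F : Type*) [Field F] [Fintype F] (hF : Fintype.card F = p ^ m)
    (E : Type*) [Field E] [Algebra F E] (β : E) (hβ : IsPrimitiveRoot β (2 ^ r))
    (N : ℕ) (hN : N = 2 ^ r * p ^ s) (hf : (X ^ N - 1 : Polynomial F) ≠ 0)
    (j : ℤ → ℕ) (hj : ∀ t ∈ ({0, 2 ^ (r - 1), 2 ^ (r - 2)} : Finset ℤ) ∪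
      (Finset.Icc 3 r).biUnion (fun i =>
        ({1, -1} : Finset ℤ).image fun u => 2 ^ (r - i) * u), j t ≤ p ^ s)
    (C : Ideal (AdjoinRoot (X ^ N - 1 : Polynomial F)))
    (hC : C = Ideal.span {AdjoinRoot.mk (X ^ N - 1 : Polynomial F)
      (minpoly F (β ^ (0 : ℤ)) ^ j 0 *
        minpoly F (β ^ ((2 : ℤ) ^ (r - 1))) ^ j (2 ^ (r - 1)) *
        minpoly F (β ^ ((2 : ℤ) ^ (r - 2))) ^ j (2 ^ (r - 2)) *
        ∏ i ∈ Finset.Icc 3 r, ∏ u ∈ ({1, -1} : Finset ℤ),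
          minpoly F (β ^ ((2 : ℤ) ^ (r - i) * u)) ^ j (2 ^ (r - i) * u))}) :
    dualCode hf C = ↑(Ideal.span {AdjoinRoot.mk (X ^ N - 1 : Polynomial F)
      (minpoly F (β ^ (0 : ℤ)) ^ (p ^ s - j 0) *
        minpoly F (β ^ ((2 : ℤ) ^ (r - 1))) ^ (p ^ s - j (2 ^ (r - 1))) *
        minpoly F (β ^ ((2 : ℤ) ^ (r - 2))) ^ (p ^ s - j (2 ^ (r - 2))) *
        ∏ i ∈ Finset.Icc 3 r, ∏ u ∈ ({1, -1} : Finset ℤ),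
          minpoly F (β ^ ((2 : ℤ) ^ (r - i) * u)) ^ (p ^ s - j (2 ^ (r - i) * (-u))))}) := by
  subst ha hC
  have : Fact p.Prime := ⟨hp⟩
  have : CharP F p := charP_of_card_eq_prime_pow hF
  have hNpos : 0 < N := by rw [hN]; exact Nat.mul_pos (by positivity) (pow_pos hp.pos s)
  have hcard : (Fintype.card F : ℤ) = 4 * b - 1 := by rw [hF]; push_cast; rw [hq]; norm_num
  have hbZ : Odd (b : ℤ) := by exact_mod_cast hb
  have hcard4 : Fintype.card F % 4 = 3 := by omega
  have hβ0 : β ≠ 0 := hβ.ne_zero (by positivity)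
  have hprim : ∀ i ≤ r, IsPrimitiveRoot (β ^ ((2 : ℤ) ^ (r - i))) (2 ^ i) := fun i hi => by
    have h := hβ.pow (a := 2 ^ (r - i)) (b := 2 ^ i) (by positivity)
      (by rw [← pow_add, Nat.sub_add_cancel hi])
    exact_mod_cast h
  have h1 : β ^ ((2 : ℤ) ^ (r - 1)) = -1 := (hprim 1 (by omega)).eq_neg_one_of_two_right
  have h2 : (β ^ ((2 : ℤ) ^ (r - 2))) ^ 2 = -1 := by
    rw [← h1, ← zpow_natCast, ← zpow_mul]
    congr 1
    rw [show r - 1 = r - 2 + 1 by omega, pow_succ]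
    rfl
  have hm0 : minpoly F (β ^ (0 : ℤ)) = X - 1 := by rw [zpow_zero, minpoly.one]
  have hm1 : minpoly F (β ^ ((2 : ℤ) ^ (r - 1))) = X + 1 := by
    rw [h1, show (-1 : E) = algebraMap F E (-1) by simp, minpoly.eq_X_sub_C]
    simp
  have hm2 : minpoly F (β ^ ((2 : ℤ) ^ (r - 2))) = X ^ 2 + 1 :=
    minpoly_of_sq_eq_neg_one hcard4 h2
  have hlevel : ∀ i ∈ Finset.Icc 3 r, minpoly F (β ^ ((2 : ℤ) ^ (r - i))) *
      minpoly F (β ^ ((2 : ℤ) ^ (r - i)))⁻¹ = X ^ 2 ^ (i - 1) + 1 := fun i hi => by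
    obtain ⟨hi3, hir⟩ := Finset.mem_Icc.1 hi
    obtain ⟨n, rfl⟩ := Nat.exists_eq_add_of_le' hi3
    exact (hprim _ hir).minpoly_mul_minpoly_inv hbZ hcard
  have hpair : ∀ (i : ℕ) (e : ℤ → ℕ), ∏ u ∈ ({1, -1} : Finset ℤ),
      minpoly F (β ^ ((2 : ℤ) ^ (r - i) * u)) ^ e u =
      minpoly F (β ^ ((2 : ℤ) ^ (r - i))) ^ e 1 *
        minpoly F (β ^ ((2 : ℤ) ^ (r - i)))⁻¹ ^ e (-1) := fun i e => by
    rw [Finset.prod_pair (by norm_num), mul_one, mul_neg_one, zpow_neg]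
  have hj0 : j 0 ≤ p ^ s := hj _ (by simp)
  have hj1 : j (2 ^ (r - 1)) ≤ p ^ s := hj _ (by simp)
  have hj2 : j (2 ^ (r - 2)) ≤ p ^ s := hj _ (by simp)
  have hju : ∀ i ∈ Finset.Icc 3 r, ∀ u ∈ ({1, -1} : Finset ℤ),
      j (2 ^ (r - i) * u) ≤ p ^ s := fun i hi u hu =>
    hj _ (Finset.mem_union_right _
      (Finset.mem_biUnion.2 ⟨i, hi, Finset.mem_image_of_mem _ hu⟩))
  have hsplit : ∀ (a : F[X]) {k : ℕ}, k ≤ p ^ s → a ^ k * a ^ (p ^ s - k) = a ^ p ^ s :=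
    fun a k hk => by rw [← pow_add, Nat.add_sub_cancel' hk]
  rw [CyclicCode.dualCode_span_singleton hf hNpos (h :=
      minpoly F (β ^ (0 : ℤ)) ^ (p ^ s - j 0) *
        minpoly F (β ^ ((2 : ℤ) ^ (r - 1))) ^ (p ^ s - j (2 ^ (r - 1))) *
        minpoly F (β ^ ((2 : ℤ) ^ (r - 2))) ^ (p ^ s - j (2 ^ (r - 2))) *
        ∏ i ∈ Finset.Icc 3 r, ∏ u ∈ ({1, -1} : Finset ℤ),
          minpoly F (β ^ ((2 : ℤ) ^ (r - i) * u)) ^ (p ^ s - j (2 ^ (r - i) * u)))]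
  · refine congrArg _ (CyclicCode.IsReciprocal.mul (.mul (.mul (.pow ?_ _) (.pow ?_ _))
      (.pow ?_ _)) (.prod _ fun i _ => ?_))
    · simpa using CyclicCode.isReciprocal_minpoly_inv (F := F) hNpos (one_ne_zero (α := E))
    · have h := CyclicCode.isReciprocal_minpoly_inv (F := F) hNpos (zpow_ne_zero (2 ^ (r - 1)) hβ0)
      rwa [h1, inv_neg_one, ← h1] at h
    · have h := CyclicCode.isReciprocal_minpoly_inv (F := F) hNpos (zpow_ne_zero (2 ^ (r - 2)) hβ0)
      rwa [minpoly_of_sq_eq_neg_one (y := (β ^ ((2 : ℤ) ^ (r - 2)))⁻¹) hcard4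
        (by rw [inv_pow, h2, inv_neg_one]), ← hm2] at h
    · rw [hpair i (fun u => p ^ s - j (2 ^ (r - i) * u)),
        hpair i (fun u => p ^ s - j (2 ^ (r - i) * -u)), neg_neg, mul_comm]
      have hγ0 := zpow_ne_zero (2 ^ (r - i)) hβ0
      have h := CyclicCode.isReciprocal_minpoly_inv (F := F) hNpos (inv_ne_zero hγ0)
      rw [inv_inv] at h
      exact (h.pow _).mul ((CyclicCode.isReciprocal_minpoly_inv hNpos hγ0).pow _)
  · rw [mul_mul_mul_comm, mul_mul_mul_comm (_ * _) (_ ^ _) (_ * _) (_ ^ _),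
      mul_mul_mul_comm (_ ^ _) (_ ^ _), hsplit _ hj0, hsplit _ hj1, hsplit _ hj2, ← Finset.prod_mul_distrib]
    have hprod : ∀ i ∈ Finset.Icc 3 r, ((∏ u ∈ ({1, -1} : Finset ℤ),
        minpoly F (β ^ ((2 : ℤ) ^ (r - i) * u)) ^ j (2 ^ (r - i) * u)) *
        ∏ u ∈ ({1, -1} : Finset ℤ),
          minpoly F (β ^ ((2 : ℤ) ^ (r - i) * u)) ^ (p ^ s - j (2 ^ (r - i) * u))) =
        (X ^ 2 ^ (i - 1) + 1) ^ p ^ s := fun i hi => by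
      rw [← Finset.prod_mul_distrib, Finset.prod_congr rfl fun u hu => hsplit _ (hju i hi u hu),
        hpair i fun _ => p ^ s, ← mul_pow, hlevel i hi]
    rw [Finset.prod_congr rfl hprod, Finset.prod_pow, hm0, hm1, hm2, ← mul_pow, ← mul_pow,
      ← mul_pow, ← X_pow_two_pow_sub_one_eq_prod (by omega), sub_pow_char_pow, one_pow, hN,
      pow_mul]
end
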